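/- Let Ω ⊂ ℝ² be a UBC domain. There exists an independent constant C such that ∫_Ω |f − f_Ω|² dx ≤ C (|Ω| P(Ω) / r_Ω) ∫_Ω |∇f|² dx for every f ∈ H¹(Ω), where f_Ω denotes the integral average of f over Ω. -/

import Mathlib

open MeasureTheory Metric Set Filter
open scoped RealInnerProductSpace ENNReal Topology NNReal

noncomputable section

abbrev E2 : Type := EuclideanSpace ℝ (Fin 2)

namespace StokesPaper

/-- The `i`-th standard basis vector of `ℝ²`. -/
def e (i : Fin 2) : E2 := EuclideanSpace.single i (1 : ℝ)

/-- Rotation by +90°; produces the right-handed unit tangent `τ = (-ν₂, ν₁)`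
from the outer normal `ν`. -/
def rot (v : E2) : E2 := ⟪v, e 0⟫ • e 1 - ⟪v, e 1⟫ • e 0

/-- The uniform ball condition (UBC) with radius `r`: at every boundary point there are
an open interior ball and an open exterior ball of radius `r` whose boundary spheres
meet exactly at that point. -/
def IsUBCWith (Ω : Set E2) (r : ℝ) : Prop :=
  0 < r ∧ ∀ x ∈ frontier Ω, ∃ cIn cOut : E2,
    ball cIn r ⊆ Ω ∧ ball cOut r ⊆ Ωᶜ ∧ sphere cIn r ∩ sphere cOut r = {x}

/-- A UBC domain: a bounded domain satisfying the UBC for some radius. -/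
def IsUBCDomain (Ω : Set E2) : Prop :=
  IsOpen Ω ∧ IsConnected Ω ∧ Bornology.IsBounded Ω ∧ ∃ r : ℝ, IsUBCWith Ω r

/-- The maximal UBC radius `r_Ω`. -/
def ubcRadius (Ω : Set E2) : ℝ := sSup {r : ℝ | IsUBCWith Ω r}

/-- The perimeter `P(Ω) = H¹(∂Ω)`. -/
def perim (Ω : Set E2) : ℝ := (μH[1] (frontier Ω)).toReal

/-- The area `|Ω|`. -/
def area (Ω : Set E2) : ℝ := (volume Ω).toReal

/-- Boundary integral with respect to the 1-dimensional Hausdorff measure. -/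
def bInt (Ω : Set E2) (f : E2 → ℝ) : ℝ := ∫ x in frontier Ω, f x ∂μH[1]

open Classical in
/-- The signed distance function `d_Ω` (negative inside `Ω`). -/
def sdist (Ω : Set E2) (x : E2) : ℝ :=
  if x ∈ Ω then -(infDist x (frontier Ω)) else infDist x Ω

/-- The tubular neighborhood `N_r(∂Ω)`. -/
def tubNbhd (Ω : Set E2) (r : ℝ) : Set E2 := {x : E2 | infDist x (frontier Ω) < r}

/-- Pointwise vector Laplacian. -/
def vLap (u : E2 → E2) (x : E2) : E2 :=
  ∑ i : Fin 2, fderiv ℝ (fderiv ℝ u) x (e i) (e i)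

/-- Pointwise gradient of a scalar function. -/
def gradv (f : E2 → ℝ) (x : E2) : E2 := ∑ i : Fin 2, fderiv ℝ f x (e i) • e i

/-- Pointwise divergence of a vector field. -/
def divg (u : E2 → E2) (x : E2) : ℝ := ∑ i : Fin 2, ⟪fderiv ℝ u x (e i), e i⟫

/-- The entry `(∇u)_{ij} = ∂_j u_i` of the gradient matrix. -/
def gradEntry (u : E2 → E2) (x : E2) (i j : Fin 2) : ℝ := ⟪fderiv ℝ u x (e j), e i⟫

/-- The entry of the symmetric gradient `∇_sym u = (∇u + (∇u)ᵀ)/2`. -/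
def symGradEntry (u : E2 → E2) (x : E2) (i j : Fin 2) : ℝ :=
  (gradEntry u x i j + gradEntry u x j i) / 2

/-- The symmetric gradient applied to a vector. -/
def symGradApp (u : E2 → E2) (x v : E2) : E2 :=
  ∑ i : Fin 2, (∑ j : Fin 2, symGradEntry u x i j * ⟪v, e j⟫) • e i

/-- Squared Frobenius norm `|∇u|²`. -/
def gradNormSq (u : E2 → E2) (x : E2) : ℝ :=
  ∑ i : Fin 2, ∑ j : Fin 2, (gradEntry u x i j)^2

/-- Squared Frobenius norm `|∇_sym u|²`. -/
def symGradNormSq (u : E2 → E2) (x : E2) : ℝ :=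
  ∑ i : Fin 2, ∑ j : Fin 2, (symGradEntry u x i j)^2

/-- `ν` is the outer unit normal of `Ω` at the boundary point `x`, characterized via the
interior and exterior tangent balls of the uniform ball condition. -/
def IsOuterNormalAt (Ω : Set E2) (x ν : E2) : Prop :=
  ‖ν‖ = 1 ∧ ∀ r : ℝ, IsUBCWith Ω r →
    ball (x - r • ν) r ⊆ Ω ∧ ball (x + r • ν) r ⊆ Ωᶜ

/-- `∫_Ω |∇^k u|² dx`. -/
def derivSq (k : ℕ) (Ω : Set E2) (u : E2 → E2) : ℝ :=
  ∫ x in Ω, ‖iteratedFDeriv ℝ k u x‖^2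

/-- Squared Sobolev norm `‖u‖²_{H^n(Ω)}`. -/
def hSobSq (n : ℕ) (Ω : Set E2) (u : E2 → E2) : ℝ :=
  ∑ k ∈ Finset.range (n + 1), derivSq k Ω u

/-- Mayer-Vietoris type statement: `H₁(ℝ²) = 0`. -/
lemma mayer_vietoris {U N V1 V2 T1 T2 : Set E2} (hU : IsOpen U) (hN : IsOpen N)
    (hUN : U ∪ N = univ) (hV1 : IsOpen V1) (hV2 : IsOpen V2) (hd : Disjoint V1 V2)
    (hV : V1 ∪ V2 = U ∩ N) (hT1 : IsPreconnected T1) (hT1U : T1 ⊆ U)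
    (hT2 : IsPreconnected T2) (hT2N : T2 ⊆ N) {x y : E2} (hx : x ∈ V1) (hy : y ∈ V2)
    (hx1 : x ∈ T1) (hy1 : y ∈ T1) (hx2 : x ∈ T2) (hy2 : y ∈ T2) : False := by
  classical
  -- Urysohn function
  obtain ⟨χ, hχ0, hχ1, -⟩ := exists_continuous_zero_one_of_isClosed (s := Nᶜ) (t := Uᶜ)
    hN.isClosed_compl hU.isClosed_compl (by
      rw [Set.disjoint_left]; intro z hz hz'
      have : z ∈ U ∪ N := hUN ▸ mem_univ z
      rcases this with h | h
      · exact hz' h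
      · exact hz h)
  have hyV1 : y ∉ V1 := fun h => (Set.disjoint_left.1 hd) h hy
  have hxV2 : x ∉ V2 := fun h => (Set.disjoint_left.1 hd) hx h
  -- continuity helper
  have key : ∀ (a : ℝ → ℝ), Continuous a → ∀ z : E2,
      (z ∈ U ∧ (z ∉ N → a 0 = 0) ∨ z ∈ N ∧ (z ∉ U → a 1 = 0)) →
      ContinuousAt (fun z => if z ∈ V2 then a (χ z) else 0) z := by
    intro a ha z hz
    by_cases h2 : z ∈ V2
    · have : (fun z => a (χ z)) =ᶠ[𝓝 z] (fun z => if z ∈ V2 then a (χ z) else 0) := by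
        filter_upwards [hV2.mem_nhds h2] with w hw
        simp [hw]
      exact ContinuousAt.congr (by fun_prop) this
    by_cases h1 : z ∈ V1
    · have : (fun z => (0:ℝ)) =ᶠ[𝓝 z] (fun z => if z ∈ V2 then a (χ z) else 0) := by
        filter_upwards [hV1.mem_nhds h1] with w hw
        have : w ∉ V2 := fun h => (Set.disjoint_left.1 hd) hw h
        simp [this]
      exact ContinuousAt.congr continuousAt_const this
    have hn : z ∉ U ∩ N := by rw [← hV]; simp [h1, h2]
    have h0 : a (χ z) = 0 := by
      rcases hz with ⟨hzU, hz⟩ | ⟨hzN, hz⟩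
      · have : z ∉ N := fun h => hn ⟨hzU, h⟩
        rw [hχ0 (show z ∈ Nᶜ from this)]; exact hz this
      · have : z ∉ U := fun h => hn ⟨h, hzN⟩
        rw [hχ1 (show z ∈ Uᶜ from this)]; exact hz this
    unfold ContinuousAt
    simp only [h2, if_false]
    have hc : Tendsto (fun w => |a (χ w)|) (𝓝 z) (𝓝 0) := by
      have : ContinuousAt (fun w => |a (χ w)|) z := by fun_prop
      simpa [ContinuousAt, h0] using this
    refine squeeze_zero_norm (fun w => ?_) hc
    by_cases hw : w ∈ V2 <;> simp [hw]
  -- the circle valued map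
  let F0 : E2 → ℝ := fun z => if z ∈ V2 then χ z else 0
  let F1 : E2 → ℝ := fun z => if z ∈ V2 then χ z - 1 else 0
  have hF0 : ∀ z ∈ U, ContinuousAt F0 z := fun z hz => key (fun t => t) continuous_id z (Or.inl ⟨hz, fun _ => rfl⟩)
  have hF1 : ∀ z ∈ N, ContinuousAt F1 z := fun z hz => key (fun t => t - 1) (by fun_prop) z
    (Or.inr ⟨hz, fun _ => by norm_num⟩)
  have hexp : ∀ z, Circle.exp (2 * Real.pi * F0 z) = Circle.exp (2 * Real.pi * F1 z) := by
    intro z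
    by_cases h : z ∈ V2
    · simp only [F0, F1, h, if_true, mul_sub, mul_one, Circle.exp_sub, Circle.exp_two_pi, div_one]
    · simp [F0, F1, h]
  let F : C(E2, Circle) := ⟨fun z => Circle.exp (2 * Real.pi * F0 z), by
    rw [continuous_iff_continuousAt]
    intro z
    have : z ∈ U ∪ N := hUN ▸ mem_univ z
    rcases this with h | h
    · exact Circle.exp.continuous.continuousAt.comp (continuousAt_const.mul (hF0 z h))
    · simp only [hexp]
      exact Circle.exp.continuous.continuousAt.comp (continuousAt_const.mul (hF1 z h))⟩
  obtain ⟨θ, ⟨-, hθ⟩, -⟩ := Circle.isCoveringMap_exp.existsUnique_continuousMap_lifts F x (2 * Real.pi * F0 x) rfl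
  have hθ' : ∀ z, Circle.exp (θ z) = Circle.exp (2 * Real.pi * F0 z) := fun z => congrFun hθ z
  -- integer-valued continuous functions are constant on preconnected sets
  have const : ∀ (G : E2 → ℝ) (T : Set E2), IsPreconnected T → (∀ z ∈ T, ContinuousAt G z) →
      (∀ z, Circle.exp (θ z) = Circle.exp (2 * Real.pi * G z)) → x ∈ T → y ∈ T →
      θ x / (2 * Real.pi) - G x = θ y / (2 * Real.pi) - G y := by
    intro G T hT hG hexpG hxT hyT
    have hIntg : ∀ z, ∃ n : ℤ, θ z / (2 * Real.pi) - G z = n := by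
      intro z
      obtain ⟨m, hm⟩ := Circle.exp_eq_exp.1 (hexpG z)
      refine ⟨m, ?_⟩
      rw [hm]; field_simp; ring
    choose n hn using hIntg
    have hcont : ContinuousOn (fun z => ((n z : ℤ) : ℝ)) T := by
      intro z hz
      have h1 : ContinuousAt (fun z => θ z / (2 * Real.pi) - G z) z :=
        (θ.continuous.continuousAt.div_const _).sub (hG z hz)
      have h2 : (fun z => θ z / (2 * Real.pi) - G z) = fun z => ((n z : ℤ) : ℝ) := funext hn
      rw [h2] at h1
      exact h1.continuousWithinAt
    have hcn : ContinuousOn n T := by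
      have := Int.isClosedEmbedding_coe_real.isInducing.continuousOn_iff (f := n) (s := T)
      rw [this]; exact hcont
    have := hT.constant hcn hxT hyT
    rw [hn, hn, this]
  have e0 := const F0 T1 hT1 (fun z hz => hF0 z (hT1U hz)) hθ' hx1 hy1
  have e1 := const F1 T2 hT2 (fun z hz => hF1 z (hT2N hz)) (fun z => (hθ' z).trans (hexp z)) hx2 hy2
  simp only [F0, F1, hxV2, hy, if_true, if_false] at e0 e1
  linarith

lemma le_of_sq_le_sq' {a b : ℝ} (h : a ^ 2 ≤ b ^ 2) (hb : 0 ≤ b) : a ≤ b :=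
  le_of_abs_le (abs_le_of_sq_le_sq h hb)

lemma e2_inner (v w : E2) : ⟪v, w⟫ = v 0 * w 0 + v 1 * w 1 := by
  simp [PiLp.inner_apply, Fin.sum_univ_two]; ring

lemma e2_norm_sq (v : E2) : ‖v‖ ^ 2 = v 0 ^ 2 + v 1 ^ 2 := by
  rw [← real_inner_self_eq_norm_sq, e2_inner]; ring

lemma rot_apply_zero (v : E2) : rot v 0 = - v 1 := by
  simp [rot, e, EuclideanSpace.inner_single_right]

lemma rot_apply_one (v : E2) : rot v 1 = v 0 := by
  simp [rot, e, EuclideanSpace.inner_single_right]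

lemma rot_inner_self (v : E2) : ⟪rot v, v⟫ = 0 := by
  rw [e2_inner, rot_apply_zero, rot_apply_one]; ring

lemma norm_rot (v : E2) : ‖rot v‖ = ‖v‖ := by
  have : ‖rot v‖ ^ 2 = ‖v‖ ^ 2 := by
    rw [e2_norm_sq, e2_norm_sq, rot_apply_zero, rot_apply_one]; ring
  exact (sq_eq_sq₀ (norm_nonneg _) (norm_nonneg _)).1 this

/-- Pythagoras in the frame `(rot ν, ν)`. -/
lemma frame_norm_sq {ν : E2} (hν : ‖ν‖ = 1) (w : E2) :
    ‖w‖ ^ 2 = ⟪w, rot ν⟫ ^ 2 + ⟪w, ν⟫ ^ 2 := by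
  have h : ν 0 ^ 2 + ν 1 ^ 2 = 1 := by rw [← e2_norm_sq, hν]; norm_num
  rw [e2_norm_sq, e2_inner, e2_inner, rot_apply_zero, rot_apply_one]
  linear_combination (-(w 0)^2 - (w 1)^2) * h

lemma frame_comb_norm_sq {ν : E2} (hν : ‖ν‖ = 1) (a b : ℝ) :
    ‖a • rot ν + b • ν‖ ^ 2 = a ^ 2 + b ^ 2 := by
  have h : ν 0 ^ 2 + ν 1 ^ 2 = 1 := by rw [← e2_norm_sq, hν]; norm_num
  rw [e2_norm_sq]
  simp only [PiLp.add_apply, PiLp.smul_apply, smul_eq_mul, rot_apply_zero, rot_apply_one]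
  linear_combination (a^2 + b^2) * h

/-- `ν` is a two-sided normal field of radius `r`. -/
def NormalField (Ω : Set E2) (r : ℝ) (ν : E2 → E2) : Prop :=
  ∀ p ∈ frontier Ω, ‖ν p‖ = 1 ∧ ball (p - r • ν p) r ⊆ Ω ∧ ball (p + r • ν p) r ⊆ Ωᶜ

lemma exists_normalField {Ω : Set E2} {r : ℝ} (h : IsUBCWith Ω r) : ∃ ν, NormalField Ω r ν := by
  have : ∀ p, ∃ n : E2, p ∈ frontier Ω →
      ‖n‖ = 1 ∧ ball (p - r • n) r ⊆ Ω ∧ ball (p + r • n) r ⊆ Ωᶜ := by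
    intro p
    by_cases hp : p ∈ frontier Ω
    swap
    · exact ⟨0, fun h => absurd h hp⟩
    obtain ⟨hr, h⟩ := h
    obtain ⟨a, b, ha, hb, hab⟩ := h p hp
    have hp' : p ∈ sphere a r ∩ sphere b r := by rw [hab]; rfl
    have h1 : ‖p - a‖ = r := by simpa [dist_eq_norm] using hp'.1
    have h2 : ‖p - b‖ = r := by simpa [dist_eq_norm] using hp'.2
    have h3 : a + b - p ∈ sphere a r ∩ sphere b r := by
      constructor
      · rw [mem_sphere, dist_eq_norm, ← h2, ← norm_neg]; congr 1; abel
      · rw [mem_sphere, dist_eq_norm, ← h1, ← norm_neg]; congr 1; abel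
    rw [hab, mem_singleton_iff] at h3
    refine ⟨r⁻¹ • (p - a), fun _ => ⟨?_, ?_, ?_⟩⟩
    · rw [norm_smul, h1, norm_inv, Real.norm_of_nonneg hr.le, inv_mul_cancel₀ hr.ne']
    · rw [smul_smul, mul_inv_cancel₀ hr.ne', one_smul, sub_sub_cancel]; exact ha
    · rw [smul_smul, mul_inv_cancel₀ hr.ne', one_smul]
      have : p + (p - a) = b := by
        have : b = p + p - a := by nth_rewrite 1 [← h3]; rw [← h3]; abel
        rw [this]; abel
      rw [this]; exact hb
  choose ν hν using this
  exact ⟨ν, hν⟩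

lemma ball_ball_dist {Ω : Set E2} {a b : E2} {s t : ℝ} (hs : 0 < s) (ht : 0 < t)
    (ha : ball a s ⊆ Ω) (hb : ball b t ⊆ Ωᶜ) : s + t ≤ ‖a - b‖ := by
  rw [← dist_eq_norm, ← disjoint_ball_ball_iff hs ht]
  exact disjoint_of_subset ha hb disjoint_compl_right

lemma NormalField.lipschitz {Ω : Set E2} {r : ℝ} {ν : E2 → E2} (hr : 0 < r)
    (h : NormalField Ω r ν) {p q : E2} (hp : p ∈ frontier Ω) (hq : q ∈ frontier Ω) :
    r * ‖ν p - ν q‖ ≤ ‖p - q‖ := by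
  obtain ⟨hp1, hp2, hp3⟩ := h p hp
  obtain ⟨hq1, hq2, hq3⟩ := h q hq
  have h1 := ball_ball_dist hr hr hp2 hq3
  have h2 := ball_ball_dist hr hr hq2 hp3
  have e1 : p - r • ν p - (q + r • ν q) = (p - q) - r • (ν p + ν q) := by module
  have e2 : q - r • ν q - (p + r • ν p) = -((p - q) + r • (ν p + ν q)) := by module
  rw [e1] at h1
  rw [e2, norm_neg] at h2
  have par := parallelogram_law_with_norm ℝ (p - q) (r • (ν p + ν q))
  have par2 := parallelogram_law_with_norm ℝ (ν p) (ν q)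
  rw [hp1, hq1] at par2
  rw [norm_smul, Real.norm_of_nonneg hr.le] at par
  have h1' : (r + r) * (r + r) ≤ ‖p - q - r • (ν p + ν q)‖ * ‖p - q - r • (ν p + ν q)‖ :=
    mul_self_le_mul_self (by positivity) h1
  have h2' : (r + r) * (r + r) ≤ ‖p - q + r • (ν p + ν q)‖ * ‖p - q + r • (ν p + ν q)‖ :=
    mul_self_le_mul_self (by positivity) h2
  refine le_of_sq_le_sq' ?_ (norm_nonneg _)
  nlinarith

lemma not_mem_of_frontier {Ω : Set E2} (hΩ : IsOpen Ω) {q a : E2} {s : ℝ} (hq : q ∈ frontier Ω)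
    (h : ball a s ⊆ Ω ∨ ball a s ⊆ Ωᶜ) : s ≤ ‖q - a‖ := by
  by_contra hlt
  push Not at hlt
  have hm : q ∈ ball a s := by rwa [mem_ball, dist_eq_norm]
  rcases h with h | h
  · have : q ∉ interior Ω := hq.2
    rw [hΩ.interior_eq] at this
    exact this (h hm)
  · have : q ∈ closure Ω := hq.1
    rw [_root_.mem_closure_iff] at this
    obtain ⟨z, hz, hz'⟩ := this _ isOpen_ball hm
    exact h hz hz'

lemma NormalField.flat {Ω : Set E2} (hΩ : IsOpen Ω) {r : ℝ} {ν : E2 → E2} (hr : 0 < r)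
    (h : NormalField Ω r ν) {p q : E2} (hp : p ∈ frontier Ω) (hq : q ∈ frontier Ω) :
    2 * r * |⟪q - p, ν p⟫| ≤ ‖q - p‖ ^ 2 := by
  obtain ⟨hp1, hp2, hp3⟩ := h p hp
  have h1 := not_mem_of_frontier hΩ hq (Or.inl hp2)
  have h2 := not_mem_of_frontier hΩ hq (Or.inr hp3)
  have e1 : q - (p - r • ν p) = (q - p) + r • ν p := by module
  have e2 : q - (p + r • ν p) = (q - p) - r • ν p := by module
  rw [e1] at h1
  rw [e2] at h2
  have s1 := norm_add_sq_real (q - p) (r • ν p)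
  have s2 := norm_sub_sq_real (q - p) (r • ν p)
  rw [norm_smul, Real.norm_of_nonneg hr.le, hp1, inner_smul_right] at s1 s2
  have h1' := mul_self_le_mul_self hr.le h1
  have h2' := mul_self_le_mul_self hr.le h2
  rw [mul_comm, ← le_div_iff₀ (by positivity), abs_le]
  constructor
  · rw [neg_le, ← sub_nonneg]
    have : 0 ≤ (‖q - p‖ ^ 2 + 2 * r * ⟪q - p, ν p⟫) / (2 * r) := by
      apply div_nonneg _ (by positivity); nlinarith
    have e3 : (‖q - p‖ ^ 2 + 2 * r * ⟪q - p, ν p⟫) / (2 * r) =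
        ‖q - p‖ ^ 2 / (2 * r) - - ⟪q - p, ν p⟫ := by
      rw [add_div, mul_div_cancel_left₀ _ (by positivity)]; ring
    rwa [e3] at this
  · rw [le_div_iff₀ (by positivity)]; nlinarith

/-- A nearest boundary point of an interior point lies in normal direction. -/
lemma NormalField.nearest {Ω : Set E2} {r : ℝ} {ν : E2 → E2} (hr : 0 < r)
    (h : NormalField Ω r ν) {z p : E2} {d : ℝ} (hd : 0 < d) (hp : p ∈ frontier Ω)
    (hz : ball z d ⊆ Ω) (hzp : ‖z - p‖ = d) : z = p - d • ν p := by
  obtain ⟨hp1, hp2, hp3⟩ := h p hp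
  have h1 := ball_ball_dist hd hr hz hp3
  have e1 : z - (p + r • ν p) = (z - p) - r • ν p := by module
  rw [e1] at h1
  have s1 := norm_sub_sq_real (z - p) (r • ν p)
  rw [norm_smul, Real.norm_of_nonneg hr.le, hp1, inner_smul_right, hzp] at s1
  have h1' := mul_self_le_mul_self (by positivity) h1
  have hi : r * (⟪z - p, ν p⟫ + d) ≤ 0 := by nlinarith
  have hi' : ⟪z - p, ν p⟫ + d ≤ 0 := by
    by_contra hc; push Not at hc; nlinarith
  have s2 := norm_add_sq_real (z - p) (d • ν p)
  rw [norm_smul, Real.norm_of_nonneg hd.le, hp1, inner_smul_right, hzp] at s2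
  have : ‖z - p + d • ν p‖ ^ 2 ≤ 0 := by nlinarith
  have : ‖z - p + d • ν p‖ = 0 := by
    have := sq_nonneg ‖z - p + d • ν p‖
    exact pow_eq_zero_iff (two_ne_zero) |>.1 (by linarith)
  rw [norm_eq_zero] at this
  rw [eq_sub_iff_add_eq, ← sub_eq_zero, ← this]; abel

/-- Projection of a set onto the line spanned by a unit vector does not increase `H¹`. -/
lemma volume_proj_le (A : Set E2) (p τ : E2) (hτ : ‖τ‖ = 1) :
    volume ((fun z => ⟪z - p, τ⟫) '' A) ≤ μH[1] A := by
  have hl : LipschitzWith 1 (fun z : E2 => ⟪z - p, τ⟫) := by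
    apply LipschitzWith.of_dist_le_mul
    intro a b
    rw [Real.dist_eq, ← inner_sub_left, dist_eq_norm, NNReal.coe_one, one_mul]
    have := abs_real_inner_le_norm (a - p - (b - p)) τ
    rwa [hτ, mul_one, sub_sub_sub_cancel_right] at *
  have := hl.hausdorffMeasure_image_le (d := 1) zero_le_one A
  simpa [hausdorffMeasure_real] using this

lemma preconnected_frontier {T s : Set E2} (hT : IsPreconnected T) (h1 : (T ∩ s).Nonempty)
    (h2 : (T ∩ sᶜ).Nonempty) : (T ∩ frontier s).Nonempty := by
  by_contra hne
  have hcov : T ⊆ interior s ∪ interior sᶜ := by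
    intro z hz
    by_contra hz'
    simp only [mem_union, not_or, interior_compl, mem_compl_iff, not_not] at hz'
    exact hne ⟨z, hz, hz'.2, hz'.1⟩
  obtain ⟨a, haT, ha⟩ := h1
  obtain ⟨b, hbT, hb⟩ := h2
  have ha' : a ∈ interior s := by
    rcases hcov haT with h | h
    · exact h
    · exact absurd ha (interior_subset h)
  have hb' : b ∈ interior sᶜ := by
    rcases hcov hbT with h | h
    · exact absurd (interior_subset h) hb
    · exact h
  obtain ⟨z, -, hz1, hz2⟩ := hT _ _ isOpen_interior isOpen_interior hcov ⟨a, haT, ha'⟩ ⟨b, hbT, hb'⟩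
  exact interior_subset hz2 (interior_subset hz1)

lemma segment_frontier {Ω : Set E2} {a b : E2} (ha : a ∈ Ω) (hb : b ∉ Ω) :
    ∃ t ∈ Icc (0:ℝ) 1, a + t • (b - a) ∈ frontier Ω := by
  have : (segment ℝ a b ∩ frontier Ω).Nonempty :=
    preconnected_frontier (convex_segment a b).isPreconnected
      ⟨a, left_mem_segment ℝ a b, ha⟩ ⟨b, right_mem_segment ℝ a b, hb⟩
  obtain ⟨z, hz, hz'⟩ := this
  rw [segment_eq_image'] at hz
  obtain ⟨t, ht, rfl⟩ := hz
  exact ⟨t, ht, hz'⟩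

lemma NormalField.perim_lower {Ω : Set E2} {r : ℝ} {ν : E2 → E2} (hr : 0 < r)
    (h : NormalField Ω r ν) {p : E2} (hp : p ∈ frontier Ω) :
    ENNReal.ofReal r ≤ μH[1] (frontier Ω ∩ ball p r) := by
  obtain ⟨hp1, hp2, hp3⟩ := h p hp
  refine le_trans ?_ (volume_proj_le _ p (rot (ν p)) (by rw [norm_rot, hp1]))
  have : Ioo (-(r/2)) (r/2) ⊆ (fun z => ⟪z - p, rot (ν p)⟫) '' (frontier Ω ∩ ball p r) := by
    intro s hs
    have hs2 : s ^ 2 < (r/2)^2 := by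
      apply sq_lt_sq' hs.1 hs.2
    have m1 : p + s • rot (ν p) - (r/2) • ν p ∈ Ω := by
      apply hp2
      rw [mem_ball, dist_eq_norm]
      have : p + s • rot (ν p) - (r/2) • ν p - (p - r • ν p) = s • rot (ν p) + (r/2) • ν p := by
        module
      rw [this]
      apply lt_of_pow_lt_pow_left₀ 2 hr.le
      rw [frame_comb_norm_sq hp1]; nlinarith
    have m2 : p + s • rot (ν p) + (r/2) • ν p ∈ Ωᶜ := by
      apply hp3
      rw [mem_ball, dist_eq_norm]
      have : p + s • rot (ν p) + (r/2) • ν p - (p + r • ν p) = s • rot (ν p) + (-r/2) • ν p := by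
        module
      rw [this]
      apply lt_of_pow_lt_pow_left₀ 2 hr.le
      rw [frame_comb_norm_sq hp1]; nlinarith
    obtain ⟨t, ht, htf⟩ := segment_frontier m1 m2
    have e1 : p + s • rot (ν p) - (r/2) • ν p +
        t • (p + s • rot (ν p) + (r/2) • ν p - (p + s • rot (ν p) - (r/2) • ν p)) =
        p + (s • rot (ν p) + (t * r - r/2) • ν p) := by module
    rw [e1] at htf
    refine ⟨_, ⟨htf, ?_⟩, ?_⟩
    · rw [mem_ball, dist_eq_norm, add_sub_cancel_left]
      apply lt_of_pow_lt_pow_left₀ 2 hr.le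
      rw [frame_comb_norm_sq hp1]
      have : (t * r - r/2)^2 ≤ (r/2)^2 := by
        have := ht.1; have := ht.2
        apply sq_le_sq'  <;> nlinarith
      nlinarith
    · simp only [add_sub_cancel_left]
      rw [inner_add_left, inner_smul_left, inner_smul_left, real_inner_self_eq_norm_sq, norm_rot,
        hp1, real_inner_comm, rot_inner_self]
      simp
  refine le_trans ?_ (measure_mono this)
  rw [Real.volume_Ioo]
  apply ENNReal.ofReal_le_ofReal; linarith

lemma NormalField.perim_finite {Ω : Set E2} (hΩ : IsOpen Ω) (hb : Bornology.IsBounded Ω) {r : ℝ}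
    {ν : E2 → E2} (hr : 0 < r) (h : NormalField Ω r ν) : μH[1] (frontier Ω) < ∞ := by
  have hK : IsCompact (frontier Ω) := by
    apply Metric.isCompact_of_isClosed_isBounded isClosed_frontier
    exact hb.closure.subset frontier_subset_closure
  apply hK.measure_lt_top_of_nhdsWithin
  intro p hp
  refine ⟨frontier Ω ∩ ball p (r/4), inter_mem_nhdsWithin _ (ball_mem_nhds _ (by positivity)), ?_⟩
  set A := frontier Ω ∩ ball p (r/4) with hA
  set φ : E2 → ℝ := fun z => ⟪z - p, rot (ν p)⟫ with hφ
  have hp1 := (h p hp).1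
  have anti : ∀ q ∈ A, ∀ q' ∈ A, dist q q' ≤ 2 * dist (φ q) (φ q') := by
    intro q hq q' hq'
    have e1 : φ q - φ q' = ⟪q - q', rot (ν p)⟫ := by
      simp only [hφ]; rw [← inner_sub_left, sub_sub_sub_cancel_right]
    rw [dist_eq_norm, Real.dist_eq, e1]
    have hq1 : ‖q - p‖ < r/4 := by simpa [dist_eq_norm] using hq.2
    have hq2 : ‖q' - p‖ < r/4 := by simpa [dist_eq_norm] using hq'.2
    have hqq : ‖q - q'‖ ≤ r/2 := by
      have := norm_sub_le (q - p) (q' - p)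
      rw [sub_sub_sub_cancel_right] at this
      linarith
    have f1 := h.flat hΩ hr hq'.1 hq.1
    have f2 := h.lipschitz hr hp hq'.1
    rw [norm_sub_rev p q'] at f2
    have f3 : |⟪q - q', ν p - ν q'⟫| ≤ ‖q - q'‖ * ‖ν p - ν q'‖ := abs_real_inner_le_norm _ _
    have f4 : ‖ν p - ν q'‖ ≤ 1/4 := by
      by_contra hc; push Not at hc; nlinarith
    have f5 : |⟪q - q', ν q'⟫| ≤ ‖q - q'‖ / 4 := by
      by_contra hc; push Not at hc
      nlinarith [norm_nonneg (q - q')]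
    have f6 : |⟪q - q', ν p⟫| ≤ ‖q - q'‖ / 2 := by
      have : ⟪q - q', ν p⟫ = ⟪q - q', ν p - ν q'⟫ + ⟪q - q', ν q'⟫ := by
        rw [← inner_add_right, sub_add_cancel]
      rw [this]
      have := abs_add_le ⟪q - q', ν p - ν q'⟫ ⟪q - q', ν q'⟫
      nlinarith [norm_nonneg (q - q')]
    have f7 := frame_norm_sq hp1 (q - q')
    have f8 : ⟪q - q', ν p⟫ ^ 2 ≤ (‖q - q'‖ / 2) ^ 2 := by
      rw [← sq_abs]; gcongr
    refine le_of_sq_le_sq' ?_ (by positivity)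
    rw [mul_pow, sq_abs]
    nlinarith
  have inj : InjOn φ A := by
    intro q hq q' hq' he
    have := anti q hq q' hq'
    rw [he, dist_self, mul_zero] at this
    exact dist_le_zero.1 this
  have hlip : LipschitzOnWith 2 (Function.invFunOn φ A) (φ '' A) := by
    apply LipschitzOnWith.of_dist_le_mul
    rintro _ ⟨q, hq, rfl⟩ _ ⟨q', hq', rfl⟩
    rw [inj.leftInvOn_invFunOn hq, inj.leftInvOn_invFunOn hq']
    exact anti q hq q' hq'
  have hm := hlip.hausdorffMeasure_image_le (d := 1) zero_le_one
  have him : Function.invFunOn φ A '' (φ '' A) = A := by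
    exact inj.invFunOn_image Subset.rfl
  rw [him, hausdorffMeasure_real] at hm
  refine lt_of_le_of_lt hm ?_
  have hsub : φ '' A ⊆ Icc (-r) r := by
    rintro _ ⟨q, hq, rfl⟩
    have hq1 : ‖q - p‖ < r/4 := by simpa [dist_eq_norm] using hq.2
    have := abs_real_inner_le_norm (q - p) (rot (ν p))
    rw [norm_rot, hp1] at this
    exact abs_le.1 (by linarith)
  refine ENNReal.mul_lt_top (by simp) (lt_of_le_of_lt (measure_mono hsub) (by simp))

lemma dist_le_perim {Ω : Set E2} (hc : IsPreconnected Ω) (hb : Bornology.IsBounded Ω)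
    {x y : E2} (hx : x ∈ Ω) (hy : y ∈ Ω) : ENNReal.ofReal (dist x y) ≤ μH[1] (frontier Ω) := by
  by_cases hxy : x = y
  · simp [hxy]
  set L := ‖y - x‖ with hL
  have hLpos : 0 < L := norm_pos_iff.2 (sub_ne_zero.2 (Ne.symm hxy))
  set τ : E2 := L⁻¹ • (y - x) with hτ
  have hτ1 : ‖τ‖ = 1 := by
    rw [hτ, norm_smul, ← hL, norm_inv, Real.norm_of_nonneg hLpos.le, inv_mul_cancel₀ hLpos.ne']
  refine le_trans ?_ (volume_proj_le _ x τ hτ1)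
  have : Icc 0 L ⊆ (fun z => ⟪z - x, τ⟫) '' (frontier Ω) := by
    intro s hs
    have hcont : ContinuousOn (fun z : E2 => ⟪z - x, τ⟫) Ω := by fun_prop
    have h1 := hc.intermediate_value hx hy hcont
    have h2 : s ∈ Icc ⟪x - x, τ⟫ ⟪y - x, τ⟫ := by
      rw [sub_self, inner_zero_left, hτ, inner_smul_right, real_inner_self_eq_norm_sq, ← hL]
      have : L⁻¹ * L ^ 2 = L := by field_simp
      rw [this]; exact hs
    obtain ⟨z, hz, hzs⟩ := h1 h2
    obtain ⟨R, hR⟩ := hb.subset_ball z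
    have hout : z + R • rot τ ∉ Ω := by
      intro hcon
      have := hR hcon
      rw [mem_ball, dist_eq_norm, add_sub_cancel_left, norm_smul, norm_rot, hτ1, mul_one] at this
      exact absurd this (not_lt.2 (le_abs_self R))
    obtain ⟨t, ht, htf⟩ := segment_frontier hz hout
    refine ⟨_, htf, ?_⟩
    have e1 : z + t • (z + R • rot τ - z) - x = (z - x) + (t * R) • rot τ := by module
    simp only [e1]
    rw [inner_add_left, inner_smul_left, rot_inner_self]
    simpa using hzs
  refine le_trans ?_ (measure_mono this)
  rw [Real.volume_Icc, sub_zero, dist_comm, dist_eq_norm]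

lemma vol_ball (x : E2) {ρ : ℝ} (hρ : 0 ≤ ρ) : volume (ball x ρ) = ENNReal.ofReal (Real.pi * ρ ^ 2) := by
  rw [EuclideanSpace.volume_ball_fin_two, mul_comm, ENNReal.ofReal_mul Real.pi_pos.le,
    ENNReal.ofReal_pow hρ]

/-- `F` is `ε`-separated. -/
def Sep (F : Finset E2) (ε : ℝ) : Prop := ∀ u ∈ F, ∀ v ∈ F, u ≠ v → ε ≤ dist u v

lemma Sep.mono {F F' : Finset E2} {ε : ℝ} (h : Sep F ε) (hF : F' ⊆ F) : Sep F' ε :=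
  fun u hu v hv => h u (hF hu) v (hF hv)

lemma Sep.card_volume {F : Finset E2} {ε : ℝ} (h : Sep F ε) (hε : 0 < ε) {A : Set E2}
    (hA : ∀ u ∈ F, ball u (ε/2) ⊆ A) :
    (F.card : ℝ≥0∞) * ENNReal.ofReal (Real.pi * (ε/2) ^ 2) ≤ volume A := by
  have h1 : volume (⋃ u ∈ F, ball u (ε/2)) = ∑ u ∈ F, volume (ball u (ε/2)) := by
    apply measure_biUnion_finset
    · intro u hu v hv huv
      apply ball_disjoint_ball
      have := h u hu v hv huv
      linarith
    · intro u _; exact measurableSet_ball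
  have h2 : ∀ u : E2, volume (ball u (ε/2)) = ENNReal.ofReal (Real.pi * (ε/2) ^ 2) :=
    fun u => vol_ball u (by positivity)
  simp only [h2, Finset.sum_const, nsmul_eq_mul] at h1
  rw [← h1]
  exact measure_mono (iUnion₂_subset hA)

lemma Sep.card_ball {F : Finset E2} {ε : ℝ} (h : Sep F ε) (hε : 0 < ε) {x : E2} {R : ℝ} (hR : 0 ≤ R)
    (hF : ∀ u ∈ F, dist u x < R) : (F.card : ℝ) * ε ^ 2 ≤ (2 * R + ε) ^ 2 := by
  have h1 := h.card_volume hε (A := ball x (R + ε/2)) (fun u hu => by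
    apply ball_subset_ball'
    have := hF u hu
    linarith)
  rw [vol_ball x (by positivity), ← ENNReal.ofReal_natCast, ← ENNReal.ofReal_mul (by positivity),
    ENNReal.ofReal_le_ofReal_iff (by positivity)] at h1
  have h2 : Real.pi * ((F.card : ℝ) * ε ^ 2) ≤ Real.pi * (2 * R + ε) ^ 2 := by nlinarith
  exact le_of_mul_le_mul_left h2 Real.pi_pos

lemma overlap_sum (μ : Measure E2) {G : E2 → ℝ≥0∞} (hG : Measurable G) (A : Set E2) (F : Finset E2)
    (R : ℝ) (M : ℕ) (hM : ∀ x, (F.filter (fun u => dist u x < R)).card ≤ M) :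
    ∑ u ∈ F, ∫⁻ x in A ∩ ball u R, G x ∂μ ≤ M * ∫⁻ x in A, G x ∂μ := by
  have h1 : ∀ u : E2, ∫⁻ x in A ∩ ball u R, G x ∂μ =
      ∫⁻ x in A, (ball u R).indicator G x ∂μ := by
    intro u
    rw [lintegral_indicator measurableSet_ball, Measure.restrict_restrict measurableSet_ball,
      inter_comm]
  simp_rw [h1]
  rw [← lintegral_finsetSum _ (fun u _ => hG.indicator measurableSet_ball),
    ← lintegral_const_mul _ hG]
  apply lintegral_mono
  intro x
  simp only
  have h2 : ∀ u : E2, (ball u R).indicator G x = if dist u x < R then G x else 0 := by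
    intro u
    simp [indicator, dist_comm]
  simp_rw [h2]
  rw [← Finset.sum_filter, Finset.sum_const, nsmul_eq_mul]
  gcongr
  exact_mod_cast hM x

lemma exists_net {K A : Set E2} {ε : ℝ} (hε : 0 < ε) (hA : volume A ≠ ∞)
    (hKA : ∀ u ∈ K, ball u (ε/2) ⊆ A) :
    ∃ F : Finset E2, (↑F ⊆ K) ∧ Sep F ε ∧ ∀ k ∈ K, ∃ u ∈ F, dist k u < ε := by
  classical
  set S : Set ℕ := {n | ∃ F : Finset E2, F.card = n ∧ (↑F ⊆ K) ∧ Sep F ε} with hS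
  have hne : S.Nonempty := ⟨0, ∅, by simp, by simp, by simp [Sep]⟩
  have hbdd : BddAbove S := by
    refine ⟨⌈(volume A).toReal / (Real.pi * (ε/2) ^ 2)⌉₊, ?_⟩
    rintro n ⟨F, rfl, hFK, hF⟩
    have h1 := hF.card_volume hε (fun u hu => hKA u (hFK hu))
    have h2 := ENNReal.toReal_mono hA h1
    rw [ENNReal.toReal_mul, ENNReal.toReal_natCast, ENNReal.toReal_ofReal (by positivity),
      ← le_div_iff₀ (by positivity)] at h2
    exact_mod_cast h2.trans (Nat.le_ceil _)
  obtain ⟨F, hFc, hFK, hF⟩ := Nat.sSup_mem hne hbdd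
  refine ⟨F, hFK, hF, fun k hk => ?_⟩
  by_contra hcon
  push Not at hcon
  have hkF : k ∉ F := fun h => by have := hcon k h; simp at this; linarith
  have : F.card + 1 ∈ S := by
    refine ⟨insert k F, Finset.card_insert_of_notMem hkF, ?_, ?_⟩
    · rw [Finset.coe_insert]; exact insert_subset hk hFK
    · intro u hu v hv huv
      rw [Finset.mem_insert] at hu hv
      rcases hu with rfl | hu <;> rcases hv with rfl | hv
      · exact absurd rfl huv
      · exact hcon v hv
      · rw [dist_comm]; exact hcon u hu
      · exact hF u hu v hv huv
  have := le_csSup hbdd this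
  omega

/-- Graph telescoping. -/
lemma walk_bound {V : Type*} (Γ : SimpleGraph V) (a s : V → ℝ) (hs : ∀ v, 0 ≤ s v)
    (h : ∀ u v, Γ.Adj u v → |a u - a v| ≤ s u) {x y : V} (p : Γ.Walk x y) :
    |a x - a y| ≤ (p.support.map s).sum := by
  induction p with
  | nil => simp [hs]
  | cons hadj p ih =>
    rename_i u v w
    simp only [SimpleGraph.Walk.support_cons, List.map_cons, List.sum_cons]
    have := abs_sub_le (a u) (a v) (a w)
    linarith [h _ _ hadj]

lemma graph_bound (Γ : SimpleGraph E2) (F : Finset E2) (hΓ : ∀ u v, Γ.Adj u v → u ∈ F ∧ v ∈ F)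
    (a h : E2 → ℝ) (hh : ∀ v, 0 ≤ h v) (hadj : ∀ u v, Γ.Adj u v → (a u - a v) ^ 2 ≤ h u)
    {x y : E2} (hx : x ∈ F) (hxy : Γ.Reachable x y) :
    (a x - a y) ^ 2 ≤ F.card * ∑ u ∈ F, h u := by
  classical
  obtain ⟨p, hp⟩ := hxy.exists_isPath
  have h1 := walk_bound Γ a (fun v => √(h v)) (fun v => Real.sqrt_nonneg _)
    (fun u v huv => Real.abs_le_sqrt (hadj u v huv)) p
  have hsub : p.support.toFinset ⊆ F := by
    intro v hv
    rw [List.mem_toFinset] at hv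
    clear h1 hp
    induction p with
    | nil => simp at hv; rwa [hv]
    | cons hadj p ih =>
      rw [SimpleGraph.Walk.support_cons, List.mem_cons] at hv
      rcases hv with rfl | hv
      · exact hx
      · exact ih (hΓ _ _ hadj).2 ⟨p⟩ hv
  have h2 : (p.support.map (fun v => √(h v))).sum = ∑ v ∈ p.support.toFinset, √(h v) :=
    (List.sum_toFinset _ hp.support_nodup).symm
  rw [h2] at h1
  have h3 : |a x - a y| ≤ ∑ v ∈ F, √(h v) :=
    h1.trans (Finset.sum_le_sum_of_subset_of_nonneg hsub (fun v _ _ => Real.sqrt_nonneg _))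
  calc (a x - a y) ^ 2 = |a x - a y| ^ 2 := (sq_abs _).symm
    _ ≤ (∑ v ∈ F, √(h v)) ^ 2 := by gcongr
    _ ≤ F.card * ∑ v ∈ F, √(h v) ^ 2 := sq_sum_le_card_mul_sum_sq
    _ = _ := by
      congr 1
      exact Finset.sum_congr rfl (fun v _ => Real.sq_sqrt (hh v))

lemma sq_lintegral_le {α : Type*} [MeasurableSpace α] (μ : Measure α) {h : α → ℝ≥0∞}
    (hh : AEMeasurable h μ) : (∫⁻ x, h x ∂μ) ^ 2 ≤ μ univ * ∫⁻ x, h x ^ 2 ∂μ := by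
  have := ENNReal.lintegral_mul_le_Lp_mul_Lq μ (p := 2) (q := 2)
    (by constructor <;> norm_num) hh (aemeasurable_const (b := (1:ℝ≥0∞)))
  simp only [Pi.mul_apply, mul_one, ENNReal.rpow_two, one_pow, lintegral_const, one_mul] at this
  calc (∫⁻ x, h x ∂μ) ^ 2 ≤ ((∫⁻ x, h x ^ 2 ∂μ) ^ (1/2:ℝ) * μ univ ^ (1/2:ℝ)) ^ 2 := by gcongr
    _ = _ := by
      rw [mul_pow, ← ENNReal.rpow_two, ← ENNReal.rpow_two, ← ENNReal.rpow_mul, ← ENNReal.rpow_mul]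
      norm_num [mul_comm]

/-- Pointwise bound along a segment. -/
lemma segment_bound {Ω : Set E2} (hΩ : IsOpen Ω) {f : E2 → ℝ} (hf : DifferentiableOn ℝ f Ω)
    {x y : E2} (hxy : segment ℝ x y ⊆ Ω) :
    ‖f x - f y‖ₑ ^ 2 ≤ ‖y - x‖ₑ ^ 2 * ∫⁻ t in Ioc (0:ℝ) 1, ‖fderiv ℝ f (x + t • (y - x))‖ₑ ^ 2 := by
  by_cases hne : x = y
  · simp [hne]
  set I := ∫⁻ t in Ioc (0:ℝ) 1, ‖fderiv ℝ f (x + t • (y - x))‖ₑ ^ 2 with hI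
  have hn0 : ‖y - x‖ₑ ^ 2 ≠ 0 := by
    simp [sub_eq_zero, Ne.symm hne]
  by_cases hItop : I = ∞
  · rw [hItop, ENNReal.mul_top hn0]; exact le_top
  have hγ : ∀ t ∈ Icc (0:ℝ) 1, x + t • (y - x) ∈ Ω := by
    intro t ht; apply hxy; rw [segment_eq_image']; exact ⟨t, ht, rfl⟩
  have hderiv : ∀ t ∈ uIcc (0:ℝ) 1, HasDerivAt (fun t : ℝ => f (x + t • (y - x)))
      (fderiv ℝ f (x + t • (y - x)) (y - x)) t := by
    intro t ht
    rw [uIcc_of_le zero_le_one] at ht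
    have h1 : HasFDerivAt f (fderiv ℝ f (x + t • (y - x))) (x + t • (y - x)) :=
      (hf.differentiableAt (hΩ.mem_nhds (hγ t ht))).hasFDerivAt
    have h2 : HasDerivAt (fun t : ℝ => x + t • (y - x)) (y - x) t := by
      have := ((hasDerivAt_id t).smul_const (y - x)).const_add x
      simpa using this
    exact h1.comp_hasDerivAt t h2
  have hmeas : Measurable (fun t : ℝ => fderiv ℝ f (x + t • (y - x)) (y - x)) :=
    (measurable_fderiv_apply_const ℝ f (y - x)).comp (by fun_prop)
  have hmeas2 : Measurable (fun t : ℝ => ‖fderiv ℝ f (x + t • (y - x))‖ₑ ^ 2) :=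
    (((measurable_fderiv ℝ f).comp (g := fderiv ℝ f) (f := fun t : ℝ => x + t • (y - x))
      (by fun_prop)).enorm).pow_const 2
  have hb : (∫⁻ t in Ioc (0:ℝ) 1, ‖fderiv ℝ f (x + t • (y - x)) (y - x)‖ₑ) ^ 2
      ≤ ‖y - x‖ₑ ^ 2 * I := by
    refine (sq_lintegral_le _ hmeas.enorm.aemeasurable).trans ?_
    simp only [Measure.restrict_apply MeasurableSet.univ, univ_inter, Real.volume_Ioc, sub_zero,
      ENNReal.ofReal_one, one_mul]
    rw [hI, ← lintegral_const_mul _ hmeas2]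
    apply lintegral_mono
    intro t
    simp only
    rw [← mul_pow]
    gcongr
    rw [mul_comm]
    exact ContinuousLinearMap.le_opENorm _ _
  have hIntg : IntervalIntegrable (fun t : ℝ => fderiv ℝ f (x + t • (y - x)) (y - x)) volume 0 1 := by
    rw [intervalIntegrable_iff_integrableOn_Ioc_of_le zero_le_one]
    refine ⟨hmeas.aestronglyMeasurable, ?_⟩
    rw [hasFiniteIntegral_iff_enorm]
    by_contra hc
    rw [not_lt, top_le_iff] at hc
    rw [hc] at hb
    have : ‖y - x‖ₑ ^ 2 * I < ∞ := ENNReal.mul_lt_top (by simp) (lt_top_iff_ne_top.2 hItop)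
    simp at hb
    exact absurd hb this.ne
  have ftc := intervalIntegral.integral_eq_sub_of_hasDerivAt hderiv hIntg
  simp only [one_smul, add_sub_cancel, zero_smul, add_zero] at ftc
  rw [intervalIntegral.integral_of_le zero_le_one] at ftc
  have : ‖f x - f y‖ₑ = ‖f y - f x‖ₑ := by rw [← enorm_neg, neg_sub]
  rw [this, ← ftc]
  refine le_trans ?_ hb
  gcongr
  exact enorm_integral_le_lintegral_enorm _

lemma lintegral_affine (G : E2 → ℝ≥0∞) (hG : Measurable G) (a : E2) {t : ℝ} (ht : 1/2 ≤ t) :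
    ∫⁻ y, G (a + t • y) ≤ 4 * ∫⁻ z, G z := by
  have ht0 : t ≠ 0 := by positivity
  have h1 : ∫⁻ y, G (a + t • y) = ∫⁻ z, G (a + z) ∂(Measure.map (t • ·) volume) := by
    rw [lintegral_map (by fun_prop) (by fun_prop)]
  rw [h1, Measure.map_addHaar_smul _ ht0, lintegral_smul_measure, lintegral_add_left_eq_self G a]
  simp only [smul_eq_mul]
  gcongr
  have : Module.finrank ℝ E2 = 2 := by simp
  rw [this]
  have : (4 : ℝ≥0∞) = ENNReal.ofReal 4 := by norm_num
  rw [this]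
  apply ENNReal.ofReal_le_ofReal
  rw [abs_of_nonneg (by positivity), inv_le_comm₀ (by positivity) (by norm_num)]
  nlinarith

/-- Pair version of the Poincaré inequality. -/
lemma pair_poincare {Ω : Set E2} (hΩ : IsOpen Ω) {f : E2 → ℝ} (hf : DifferentiableOn ℝ f Ω)
    {X Y D : Set E2} (hX : MeasurableSet X) (hY : MeasurableSet Y) (hD : MeasurableSet D)
    (hDΩ : D ⊆ Ω) (hseg : ∀ x ∈ X, ∀ y ∈ Y, segment ℝ x y ⊆ D) {d : ℝ≥0∞}
    (hd : ∀ x ∈ X, ∀ y ∈ Y, ‖y - x‖ₑ ≤ d) :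
    ∫⁻ x in X, ∫⁻ y in Y, ‖f x - f y‖ₑ ^ 2 ≤
      d ^ 2 * (4 * (volume X + volume Y) * ∫⁻ z in D, ‖fderiv ℝ f z‖ₑ ^ 2) := by
  set G : E2 → ℝ≥0∞ := D.indicator (fun z => ‖fderiv ℝ f z‖ₑ ^ 2) with hGdef
  have hG : Measurable G := ((measurable_fderiv ℝ f).enorm.pow_const 2).indicator hD
  have hGI : ∫⁻ z in D, ‖fderiv ℝ f z‖ₑ ^ 2 = ∫⁻ z, G z := (lintegral_indicator hD _).symm
  rw [hGI]
  have hH : Measurable (fun q : (E2 × E2) × ℝ => G (q.1.1 + q.2 • (q.1.2 - q.1.1))) :=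
    hG.comp (by fun_prop)
  calc ∫⁻ x in X, ∫⁻ y in Y, ‖f x - f y‖ₑ ^ 2
      ≤ ∫⁻ x in X, ∫⁻ y in Y, d ^ 2 * ∫⁻ t in Ioc (0:ℝ) 1, G (x + t • (y - x)) := by
        apply setLIntegral_mono' hX
        intro x hx
        apply setLIntegral_mono' hY
        intro y hy
        refine (segment_bound hΩ hf ((hseg x hx y hy).trans hDΩ)).trans ?_
        refine mul_le_mul' (pow_le_pow_left' (hd x hx y hy) 2) ?_
        · apply le_of_eq
          apply setLIntegral_congr_fun measurableSet_Ioc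
          intro t ht
          have : x + t • (y - x) ∈ D := by
            apply hseg x hx y hy
            rw [segment_eq_image']; exact ⟨t, ⟨ht.1.le, ht.2⟩, rfl⟩
          simp [hGdef, this]
    _ = d ^ 2 * ∫⁻ x in X, ∫⁻ y in Y, ∫⁻ t in Ioc (0:ℝ) 1, G (x + t • (y - x)) := by
        rw [← lintegral_const_mul]
        · congr 1; ext x
          rw [lintegral_const_mul]
          have : Measurable (fun q : E2 × ℝ => G (x + q.2 • (q.1 - x))) := hG.comp (by fun_prop)
          exact this.lintegral_prod_right'
        · have h1 : Measurable (fun q : E2 × E2 => ∫⁻ t in Ioc (0:ℝ) 1, G (q.1 + t • (q.2 - q.1))) :=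
            hH.lintegral_prod_right'
          exact h1.lintegral_prod_right'
    _ = d ^ 2 * ∫⁻ t in Ioc (0:ℝ) 1, ∫⁻ x in X, ∫⁻ y in Y, G (x + t • (y - x)) := by
        congr 1
        have : ∀ x : E2, ∫⁻ y in Y, ∫⁻ t in Ioc (0:ℝ) 1, G (x + t • (y - x)) =
            ∫⁻ t in Ioc (0:ℝ) 1, ∫⁻ y in Y, G (x + t • (y - x)) := by
          intro x
          rw [lintegral_lintegral_swap]
          have : Measurable (fun q : E2 × ℝ => G (x + q.2 • (q.1 - x))) := hG.comp (by fun_prop)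
          exact this.aemeasurable
        simp_rw [this]
        rw [lintegral_lintegral_swap]
        have h1 : Measurable (fun q : (E2 × ℝ) × E2 => G (q.1.1 + q.1.2 • (q.2 - q.1.1))) :=
          hG.comp (by fun_prop)
        have h2 : Measurable (fun q : E2 × ℝ => ∫⁻ y in Y, G (q.1 + q.2 • (y - q.1))) :=
          h1.lintegral_prod_right'
        exact h2.aemeasurable
    _ ≤ d ^ 2 * ∫⁻ t in Ioc (0:ℝ) 1, 4 * (volume X + volume Y) * ∫⁻ z, G z := by
        gcongr with t
        by_cases ht : 1/2 ≤ t
        · calc ∫⁻ x in X, ∫⁻ y in Y, G (x + t • (y - x))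
              ≤ ∫⁻ x in X, 4 * ∫⁻ z, G z := by
                gcongr with x
                refine (setLIntegral_le_lintegral _ _).trans ?_
                have := lintegral_affine G hG (x - t • x) ht
                refine le_trans (le_of_eq ?_) this
                congr 1; ext y; congr 1; module
            _ = 4 * volume X * ∫⁻ z, G z := by
                simp; ring
            _ ≤ _ := by gcongr; exact le_self_add
        · push Not at ht
          rw [lintegral_lintegral_swap]
          swap
          · have : Measurable (fun q : E2 × E2 => G (q.1 + t • (q.2 - q.1))) := hG.comp (by fun_prop)
            exact this.aemeasurable
          calc ∫⁻ y in Y, ∫⁻ x in X, G (x + t • (y - x))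
              ≤ ∫⁻ y in Y, 4 * ∫⁻ z, G z := by
                gcongr with y
                refine (setLIntegral_le_lintegral _ _).trans ?_
                have := lintegral_affine G hG (t • y) (t := 1 - t) (by linarith)
                refine le_trans (le_of_eq ?_) this
                congr 1; ext x; congr 1; module
            _ = 4 * volume Y * ∫⁻ z, G z := by
                simp; ring
            _ ≤ _ := by gcongr; exact le_add_self
    _ = _ := by
        simp

/-- Jensen. -/
lemma jensen_avg {f : E2 → ℝ} {Y : Set E2} (hf : IntegrableOn f Y volume)
    (h0 : volume Y ≠ 0) (h1 : volume Y ≠ ∞) (s : ℝ) :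
    ‖s - ⨍ y in Y, f y‖ₑ ^ 2 ≤ (volume Y)⁻¹ * ∫⁻ y in Y, ‖s - f y‖ₑ ^ 2 := by
  have : NeZero (volume.restrict Y) := ⟨by simpa [Measure.restrict_eq_zero] using h0⟩
  have : IsFiniteMeasure (volume.restrict Y) := ⟨by simpa using lt_top_iff_ne_top.2 h1⟩
  set ν := ((volume.restrict Y) univ)⁻¹ • volume.restrict Y with hν
  have hfν : Integrable f ν := hf.smul_measure (by simpa using h0)
  have e1 : s - ⨍ y in Y, f y = ∫ y, (s - f y) ∂ν := by
    rw [integral_sub (integrable_const _) hfν]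
    rw [integral_const, probReal_univ, one_smul]
    rfl
  rw [e1]
  calc ‖∫ y, (s - f y) ∂ν‖ₑ ^ 2 ≤ (∫⁻ y, ‖s - f y‖ₑ ∂ν) ^ 2 := by
        gcongr; exact enorm_integral_le_lintegral_enorm _
    _ ≤ ν univ * ∫⁻ y, ‖s - f y‖ₑ ^ 2 ∂ν :=
        sq_lintegral_le _ (aestronglyMeasurable_const.sub hfν.1).enorm
    _ = _ := by
        rw [measure_univ, one_mul, hν, lintegral_smul_measure]
        simp

lemma avg_X {Ω : Set E2} (hΩ : IsOpen Ω) {f : E2 → ℝ} (hf : DifferentiableOn ℝ f Ω)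
    (hfi : IntegrableOn f Ω volume)
    {X Y D : Set E2} (hX : MeasurableSet X) (hY : MeasurableSet Y) (hD : MeasurableSet D)
    (hDΩ : D ⊆ Ω) (hYD : Y ⊆ D) (hseg : ∀ x ∈ X, ∀ y ∈ Y, segment ℝ x y ⊆ D) {d : ℝ≥0∞}
    (hd : ∀ x ∈ X, ∀ y ∈ Y, ‖y - x‖ₑ ≤ d) (h0 : volume Y ≠ 0) (h1 : volume Y ≠ ∞) :
    ∫⁻ x in X, ‖f x - ⨍ y in Y, f y‖ₑ ^ 2 ≤ (volume Y)⁻¹ * 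
      (d ^ 2 * (4 * (volume X + volume Y) * ∫⁻ z in D, ‖fderiv ℝ f z‖ₑ ^ 2)) := by
  calc ∫⁻ x in X, ‖f x - ⨍ y in Y, f y‖ₑ ^ 2
      ≤ ∫⁻ x in X, (volume Y)⁻¹ * ∫⁻ y in Y, ‖f x - f y‖ₑ ^ 2 := by
        gcongr with x
        exact jensen_avg (hfi.mono_set (hYD.trans hDΩ)) h0 h1 _
    _ = (volume Y)⁻¹ * ∫⁻ x in X, ∫⁻ y in Y, ‖f x - f y‖ₑ ^ 2 :=
        lintegral_const_mul' _ _ (by simpa using h0)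
    _ ≤ _ := by
        gcongr
        exact pair_poincare hΩ hf hX hY hD hDΩ hseg hd

lemma avg_XY {Ω : Set E2} (hΩ : IsOpen Ω) {f : E2 → ℝ} (hf : DifferentiableOn ℝ f Ω)
    (hfi : IntegrableOn f Ω volume)
    {X Y D : Set E2} (hX : MeasurableSet X) (hY : MeasurableSet Y) (hD : MeasurableSet D)
    (hDΩ : D ⊆ Ω) (hXD : X ⊆ D) (hYD : Y ⊆ D) (hseg : ∀ x ∈ X, ∀ y ∈ Y, segment ℝ x y ⊆ D)
    {d : ℝ≥0∞}
    (hd : ∀ x ∈ X, ∀ y ∈ Y, ‖y - x‖ₑ ≤ d) (h0 : volume Y ≠ 0) (h1 : volume Y ≠ ∞)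
    (h0' : volume X ≠ 0) (h1' : volume X ≠ ∞) :
    ‖(⨍ y in X, f y) - ⨍ y in Y, f y‖ₑ ^ 2 ≤ (volume X)⁻¹ * ((volume Y)⁻¹ * 
      (d ^ 2 * (4 * (volume X + volume Y) * ∫⁻ z in D, ‖fderiv ℝ f z‖ₑ ^ 2))) := by
  have h := jensen_avg (hfi.mono_set (hXD.trans hDΩ)) h0' h1' (⨍ y in Y, f y)
  rw [← enorm_neg, neg_sub]
  refine h.trans ?_
  gcongr
  refine le_trans (le_of_eq ?_) (avg_X hΩ hf hfi hX hY hD hDΩ hYD hseg hd h0 h1)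
  congr 1; ext x; rw [← enorm_neg, neg_sub]

/-- The map sending a point to the centre of a nearby ball of radius `r / 2` inside `Ω`. -/
lemma exists_centre_map {Ω : Set E2} (hΩ : IsOpen Ω) (hne : Ω ≠ univ) {r : ℝ} {ν : E2 → E2}
    (hr : 0 < r) (h : NormalField Ω r ν) :
    ∃ k : E2 → E2, (∀ z ∈ Ω, ball (k z) (r/2) ⊆ Ω ∧ dist z (k z) < r/2) ∧
      (∀ z ∈ Ω, ∀ z' ∈ Ω, dist (k z) (k z') ≤ 8 * dist z z') ∧
      (∀ z ∈ Ω, ball z (r/2) ⊆ Ω → k z = z) := by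
  classical
  have hp : ∀ z, ∃ p, z ∈ Ω → p ∈ frontier Ω ∧ 0 < infDist z Ωᶜ ∧
      z = p - infDist z Ωᶜ • ν p := by
    intro z
    by_cases hz : z ∈ Ω
    swap
    · exact ⟨0, fun h => absurd h hz⟩
    obtain ⟨p, hp, hpd⟩ := exists_mem_frontier_infDist_compl_eq_dist hz hne
    have hpΩ : p ∉ Ω := by
      have : p ∉ interior Ω := hp.2
      rwa [hΩ.interior_eq] at this
    have hpos : 0 < infDist z Ωᶜ := by
      rw [hpd, dist_pos]; rintro rfl; exact hpΩ hz
    refine ⟨p, fun _ => ⟨hp, hpos, ?_⟩⟩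
    exact h.nearest hr hpos hp (ball_infDist_compl_subset) (by rw [hpd, dist_eq_norm])
  choose p hp using hp
  refine ⟨fun z => if r/2 ≤ infDist z Ωᶜ then z else p z - (r/2) • ν (p z), ?_, ?_, ?_⟩
  · intro z hz
    obtain ⟨h1, h2, h3⟩ := hp z hz
    by_cases hc : r/2 ≤ infDist z Ωᶜ
    · simp only [hc, if_true]
      exact ⟨(ball_subset_ball hc).trans ball_infDist_compl_subset, by simpa using by positivity⟩
    · simp only [hc, if_false]
      obtain ⟨n1, n2, n3⟩ := h _ h1
      push Not at hc
      constructor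
      · refine (ball_subset_ball' ?_).trans n2
        rw [dist_eq_norm]
        have : p z - (r/2) • ν (p z) - (p z - r • ν (p z)) = (r/2) • ν (p z) := by module
        rw [this, norm_smul, n1, Real.norm_of_nonneg (by positivity)]; linarith
      · rw [dist_eq_norm]
        set δ := infDist z Ωᶜ
        have : z - (p z - (r/2) • ν (p z)) = (r/2 - δ) • ν (p z) := by
          nth_rewrite 1 [h3]; module
        rw [this, norm_smul, n1, Real.norm_of_nonneg (by linarith)]; linarith
  · have mixed : ∀ z ∈ Ω, ∀ z' ∈ Ω, r/2 ≤ infDist z Ωᶜ → infDist z' Ωᶜ < r/2 →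
        dist z (p z' - (r/2) • ν (p z')) ≤ 8 * dist z z' := by
      intro z hz z' hz' hc hc'
      obtain ⟨h1, h2, h3⟩ := hp z' hz'
      obtain ⟨n1, n2, n3⟩ := h _ h1
      have hl : infDist z Ωᶜ ≤ infDist z' Ωᶜ + dist z z' := infDist_le_infDist_add_dist
      set δ := infDist z' Ωᶜ
      have e1 : dist z' (p z' - (r/2) • ν (p z')) ≤ dist z z' := by
        rw [dist_eq_norm]
        have : z' - (p z' - (r/2) • ν (p z')) = (r/2 - δ) • ν (p z') := by
          nth_rewrite 1 [h3]; module
        rw [this, norm_smul, n1, Real.norm_of_nonneg (by linarith)]; linarith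
      have := dist_triangle z z' (p z' - (r/2) • ν (p z'))
      have := dist_nonneg (x := z) (y := z')
      linarith
    intro z hz z' hz'
    by_cases hc : r/2 ≤ infDist z Ωᶜ <;> by_cases hc' : r/2 ≤ infDist z' Ωᶜ
    · simp only [hc, hc', if_true]
      have := dist_nonneg (x := z) (y := z'); linarith
    · simp only [hc, hc', if_true, if_false]
      exact mixed z hz z' hz' hc (not_le.1 hc')
    · simp only [hc, hc', if_true, if_false]
      rw [dist_comm, dist_comm z z']
      exact mixed z' hz' z hz hc' (not_le.1 hc)
    · simp only [hc, hc', if_false]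
      push Not at hc hc'
      obtain ⟨h1, h2, h3⟩ := hp z hz
      obtain ⟨n1, -, -⟩ := h _ h1
      obtain ⟨h1', h2', h3'⟩ := hp z' hz'
      obtain ⟨n1', -, -⟩ := h _ h1'
      have hL := h.lipschitz hr h1 h1'
      have hl : infDist z Ωᶜ ≤ infDist z' Ωᶜ + dist z z' := infDist_le_infDist_add_dist
      have hl' : infDist z' Ωᶜ ≤ infDist z Ωᶜ + dist z' z := infDist_le_infDist_add_dist
      rw [dist_comm z' z] at hl'
      set δ := infDist z Ωᶜ
      set δ' := infDist z' Ωᶜ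
      have e1 : p z - p z' = (z - z') + (δ • (ν (p z) - ν (p z')) + (δ - δ') • ν (p z')) := by
        have a3 : z - z' = (p z - δ • ν (p z)) - (p z' - δ' • ν (p z')) := by rw [← h3, ← h3']
        rw [a3]; module
      have e2 : ‖p z - p z'‖ ≤ dist z z' + (δ * ‖ν (p z) - ν (p z')‖ + |δ - δ'|) := by
        rw [dist_eq_norm]
        nth_rewrite 1 [e1]
        refine (norm_add_le _ _).trans ?_
        gcongr
        refine (norm_add_le _ _).trans ?_
        rw [norm_smul, norm_smul, n1', mul_one, Real.norm_of_nonneg h2.le, Real.norm_eq_abs]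
      have e3 : |δ - δ'| ≤ dist z z' := by rw [abs_le]; constructor <;> linarith
      have e4 : δ * ‖ν (p z) - ν (p z')‖ ≤ r / 2 * ‖ν (p z) - ν (p z')‖ := by gcongr
      have e5 : ‖p z - p z'‖ ≤ 4 * dist z z' := by linarith
      rw [dist_eq_norm]
      have e6 : p z - (r/2) • ν (p z) - (p z' - (r/2) • ν (p z')) =
        (p z - p z') - (r/2) • (ν (p z) - ν (p z')) := by module
      rw [e6]
      refine (norm_sub_le _ _).trans ?_
      rw [norm_smul, Real.norm_of_nonneg (by positivity)]
      have := dist_nonneg (x := z) (y := z')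
      linarith
  · intro z hz hb
    obtain ⟨h1, h2, h3⟩ := hp z hz
    have : r/2 ≤ infDist z Ωᶜ := by
      rw [le_infDist ⟨p z, ?_⟩]
      · intro y hy
        by_contra hc
        push Not at hc
        exact hy (hb (by rwa [mem_ball, dist_comm]))
      · have : p z ∉ interior Ω := h1.2
        rwa [hΩ.interior_eq] at this
    simp only [this, if_true]

/-- The connection graph. -/
def netGraph (F : Finset E2) (ε : ℝ) : SimpleGraph E2 where
  Adj u v := u ≠ v ∧ u ∈ F ∧ v ∈ F ∧ dist u v < 3 * ε
  symm := ⟨fun u v h => ⟨h.1.symm, h.2.2.1, h.2.1, by rw [dist_comm]; exact h.2.2.2⟩⟩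
  loopless := ⟨fun u h => h.1 rfl⟩

lemma netGraph_reach {F : Finset E2} {ε : ℝ} {u v : E2} (hu : u ∈ F) (hv : v ∈ F)
    (h : dist u v < 3 * ε) : (netGraph F ε).Reachable u v := by
  by_cases huv : u = v
  · rw [huv]
  · exact SimpleGraph.Adj.reachable ⟨huv, hu, hv, h⟩

lemma net_connected {Ω : Set E2} (hΩ : IsOpen Ω) (hc : IsPreconnected Ω) (hne : Ω ≠ univ) {r : ℝ}
    {ν : E2 → E2} (hr : 0 < r) (h : NormalField Ω r ν) {ε : ℝ} (hε : 0 < ε) (hεr : ε ≤ r/4)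
    {Z F : Finset E2} (hZK : ∀ u ∈ Z, ball u (r/2) ⊆ Ω)
    (hZ : ∀ k, ball k (r/2) ⊆ Ω → ∃ u ∈ Z, dist k u < ε) {c c0 : E2} (hcZ : c ∈ Z) (hc0Z : c0 ∈ Z)
    (hF : ∀ u ∈ Z, u ∈ thickening (3 * (r/2)) (Ωᶜ ∪ segment ℝ c c0) → u ∈ F) :
    (netGraph F ε).Reachable c c0 := by
  classical
  obtain ⟨k, hk1, hk2, hk3⟩ := exists_centre_map hΩ hne hr h
  have hu : ∀ z, ∃ u, z ∈ Ω → u ∈ Z ∧ dist (k z) u < ε := by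
    intro z
    by_cases hz : z ∈ Ω
    · obtain ⟨u, hu⟩ := hZ (k z) (hk1 z hz).1
      exact ⟨u, fun _ => hu⟩
    · exact ⟨0, fun h => absurd h hz⟩
  choose u hu using hu
  set N := thickening (r/2) (Ωᶜ ∪ segment ℝ c c0) with hN
  have hNo : IsOpen N := isOpen_thickening
  have huF : ∀ z ∈ Ω ∩ N, u z ∈ F := by
    rintro z ⟨hz, hzN⟩
    apply hF _ (hu z hz).1
    rw [hN, mem_thickening_iff] at hzN
    rw [mem_thickening_iff]
    obtain ⟨s, hs, hsd⟩ := hzN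
    refine ⟨s, hs, ?_⟩
    have h1 := (hu z hz).2
    have h2 := (hk1 z hz).2
    have h3 := dist_triangle4 (u z) (k z) z s
    rw [dist_comm (u z) (k z), dist_comm (k z) z] at h3
    linarith
  have step : ∀ z ∈ Ω ∩ N, ∀ z' ∈ Ω ∩ N, dist z z' < ε/8 → (netGraph F ε).Reachable (u z) (u z') := by
    intro z hz z' hz' hd
    apply netGraph_reach (huF z hz) (huF z' hz')
    have h1 := (hu z hz.1).2
    have h2 := (hu z' hz'.1).2
    have h3 := hk2 z hz.1 z' hz'.1
    have h4 := dist_triangle4 (u z) (k z) (k z') (u z')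
    rw [dist_comm (u z) (k z)] at h4
    linarith
  have hself : ∀ z ∈ Z, z ∈ Ω := fun z hz => hZK z hz (mem_ball_self (by positivity))
  have hSN : segment ℝ c c0 ⊆ N := fun z hz => self_subset_thickening (by positivity) _ (Or.inr hz)
  have hcS : c ∈ segment ℝ c c0 := left_mem_segment ℝ c c0
  have hc0S : c0 ∈ segment ℝ c c0 := right_mem_segment ℝ c c0
  have hinF : ∀ z ∈ Z, z ∈ segment ℝ c c0 → z ∈ F := fun z hz hzS =>
    hF z hz (self_subset_thickening (by positivity) _ (Or.inr hzS))
  have hend : ∀ z ∈ Z, z ∈ segment ℝ c c0 → (netGraph F ε).Reachable z (u z) := by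
    intro z hz hzS
    have hzΩ := hself z hz
    apply netGraph_reach (hinF z hz hzS) (huF z ⟨hzΩ, hSN hzS⟩)
    have := (hu z hzΩ).2
    rw [hk3 z hzΩ (hZK z hz)] at this
    linarith
  have hopen : ∀ (P : E2 → Prop), (∀ z z', (netGraph F ε).Reachable (u z) (u z') → P z → P z') →
      IsOpen {z | z ∈ Ω ∩ N ∧ P z} := by
    intro P hP
    rw [Metric.isOpen_iff]
    rintro z ⟨hz, hzP⟩
    obtain ⟨ρ, hρ, hρs⟩ := Metric.isOpen_iff.1 (hΩ.inter hNo) z hz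
    refine ⟨min ρ (ε/8), by positivity, fun z' hz' => ?_⟩
    have hz'm := hρs (ball_subset_ball (min_le_left _ _) hz')
    refine ⟨hz'm, hP z z' (step z hz z' hz'm ?_) hzP⟩
    rw [dist_comm]
    exact lt_of_lt_of_le hz' (min_le_right _ _)
  by_contra hcon
  refine mayer_vietoris (U := Ω) (N := N)
    (V1 := {z | z ∈ Ω ∩ N ∧ (netGraph F ε).Reachable c (u z)})
    (V2 := {z | z ∈ Ω ∩ N ∧ ¬ (netGraph F ε).Reachable c (u z)}) (T1 := Ω)
    (T2 := segment ℝ c c0) (x := c) (y := c0) hΩ hNo ?_ ?_ ?_ ?_ ?_ hc Subset.rfl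
    (convex_segment c c0).isPreconnected hSN ?_ ?_ (hself c hcZ) (hself c0 hc0Z) hcS hc0S
  · rw [eq_univ_iff_forall]
    intro z
    by_cases hz : z ∈ Ω
    · exact Or.inl hz
    · exact Or.inr (self_subset_thickening (by positivity) _ (Or.inl hz))
  · exact hopen _ (fun z z' hzz hz => hz.trans hzz)
  · exact hopen _ (fun z z' hzz hz hz' => hz (hz'.trans hzz.symm))
  · rw [Set.disjoint_left]; rintro z ⟨-, hz⟩ ⟨-, hz'⟩; exact hz' hz
  · ext z
    constructor
    · rintro (hz | hz) <;> exact hz.1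
    · intro hz
      by_cases hR : (netGraph F ε).Reachable c (u z)
      · exact Or.inl ⟨hz, hR⟩
      · exact Or.inr ⟨hz, hR⟩
  · exact ⟨⟨hself c hcZ, hSN hcS⟩, hend c hcZ hcS⟩
  · exact ⟨⟨hself c0 hc0Z, hSN hc0S⟩, fun hR => hcon (hR.trans (hend c0 hc0Z hc0S).symm)⟩

/-- Counting net points near the boundary. -/
lemma count_frontier {Ω : Set E2} {r : ℝ} {ν : E2 → E2} (hr : 0 < r) (h : NormalField Ω r ν)
    (hfin : μH[1] (frontier Ω) < ∞) {F : Finset E2} {M : ℕ}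
    (hM : ∀ x, (F.filter (fun u => dist u x < 5 * (r/2))).card ≤ M)
    (hF : ∀ u ∈ F, ∃ p ∈ frontier Ω, dist u p < 3 * (r/2)) :
    (F.card : ℝ) * r ≤ M * perim Ω := by
  have h1 := overlap_sum (μH[1]) (G := fun _ => 1) measurable_const (frontier Ω) F (5 * (r/2)) M hM
  simp only [lintegral_const, one_mul, Measure.restrict_apply MeasurableSet.univ, univ_inter] at h1
  have h2 : (F.card : ℝ≥0∞) * ENNReal.ofReal r ≤ ∑ u ∈ F, μH[1] (frontier Ω ∩ ball u (5 * (r/2))) := by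
    rw [← nsmul_eq_mul, ← Finset.sum_const]
    apply Finset.sum_le_sum
    intro u hu
    obtain ⟨p, hp, hup⟩ := hF u hu
    refine (h.perim_lower hr hp).trans (measure_mono (inter_subset_inter_right _ ?_))
    apply ball_subset_ball'
    rw [dist_comm]; linarith
  have h3 := ENNReal.toReal_mono (ENNReal.mul_lt_top (by simp) hfin).ne (h2.trans h1)
  simpa [perim, ENNReal.toReal_mul, hr.le] using h3

/-- Counting net points near a segment. -/
lemma count_segment {η : ℝ} (hη : 0 < η) {c c0 : E2} {F : Finset E2} {M : ℕ}
    (hM : ∀ x, (F.filter (fun u => dist u x < 5 * η)).card ≤ M)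
    (hF : ∀ u ∈ F, ∃ p ∈ segment ℝ c c0, dist u p < 3 * η) :
    (F.card : ℝ) ≤ (dist c c0 / η + 3) * M := by
  classical
  set n := ⌈dist c c0 / η⌉₊ + 1 with hn
  have hn0 : (0:ℝ) < n := by rw [hn]; positivity
  have hLn : dist c c0 ≤ η * n := by
    have := Nat.le_ceil (dist c c0 / η)
    rw [div_le_iff₀ hη] at this
    rw [hn]; push_cast; nlinarith
  have hsub : F ⊆ (Finset.range (n+1)).biUnion
      (fun j => F.filter (fun u => dist u (c + ((j:ℝ)/n) • (c0 - c)) < 5 * η)) := by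
    intro u hu
    obtain ⟨p, hp, hup⟩ := hF u hu
    rw [segment_eq_image'] at hp
    obtain ⟨t, ht, rfl⟩ := hp
    rw [Finset.mem_biUnion]
    have htn : 0 ≤ t * n := mul_nonneg ht.1 hn0.le
    refine ⟨⌊t * n⌋₊, ?_, ?_⟩
    · rw [Finset.mem_range, Nat.lt_succ_iff]
      apply Nat.floor_le_of_le
      nlinarith [ht.2]
    · rw [Finset.mem_filter]
      refine ⟨hu, ?_⟩
      have h1 := Nat.floor_le htn
      have h2 := Nat.lt_floor_add_one (t * n)
      set j := ⌊t * n⌋₊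
      have h3 : dist (c + t • (c0 - c)) (c + ((j:ℝ)/n) • (c0 - c)) ≤ η := by
        rw [dist_add_left, dist_eq_norm, ← sub_smul, norm_smul, ← dist_eq_norm c0 c, dist_comm c0 c,
          Real.norm_of_nonneg]
        · have : t - j / n ≤ 1 / n := by
            rw [sub_le_iff_le_add, ← add_div, le_div_iff₀ hn0]; linarith
          calc (t - j/n) * dist c c0 ≤ 1 / n * (η * n) := by gcongr
            _ = η := by field_simp
        · rw [sub_nonneg, div_le_iff₀ hn0]; exact h1
      have := dist_triangle u (c + t • (c0 - c)) (c + ((j:ℝ)/n) • (c0 - c))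
      simp only at hup
      linarith
  have h1 : F.card ≤ (n+1) * M := by
    refine (Finset.card_le_card hsub).trans (Finset.card_biUnion_le.trans ?_)
    refine (Finset.sum_le_card_nsmul _ _ M (fun j _ => hM _)).trans ?_
    simp
  have h2 : (n:ℝ) ≤ dist c c0 / η + 2 := by
    rw [hn]; push_cast
    have := Nat.ceil_lt_add_one (div_nonneg (dist_nonneg (x := c) (y := c0)) hη.le)
    linarith
  calc (F.card : ℝ) ≤ ((n:ℝ)+1) * M := by exact_mod_cast h1
    _ ≤ _ := mul_le_mul_of_nonneg_right (by linarith) (Nat.cast_nonneg _)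


lemma enorm_sq_ofReal (x : ℝ) : ‖x‖ₑ ^ 2 = ENNReal.ofReal (x ^ 2) := by
  rw [← ofReal_norm, ← ENNReal.ofReal_pow (norm_nonneg _), Real.norm_eq_abs, sq_abs]

/-- The local average over a ball. -/
def locAvg (f : E2 → ℝ) (ρ : ℝ) (u : E2) : ℝ := ⨍ y in ball u ρ, f y

lemma edge_bound {Ω : Set E2} (hΩ : IsOpen Ω) {f : E2 → ℝ} (hf : DifferentiableOn ℝ f Ω)
    (hfi : IntegrableOn f Ω volume) {η : ℝ} (hη : 0 < η) {u v : E2} (hu : ball u η ⊆ Ω)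
    (huv : dist u v < η / 2) :
    ‖locAvg f (η/2) u - locAvg f (η/2) v‖ₑ ^ 2 ≤
      ENNReal.ofReal 128 * ∫⁻ z in Ω ∩ ball u η, ‖fderiv ℝ f z‖ₑ ^ 2 := by
  have hβ : 0 < Real.pi * (η/2) ^ 2 := by positivity
  have hX : ball u (η/2) ⊆ ball u η := ball_subset_ball (by linarith)
  have hY : ball v (η/2) ⊆ ball u η := ball_subset_ball' (by rw [dist_comm]; linarith)
  have hv := fun w : E2 => vol_ball w (ρ := η/2) (by positivity)
  have h := avg_XY hΩ hf hfi (X := ball u (η/2)) (Y := ball v (η/2)) (D := Ω ∩ ball u η)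
    (d := ENNReal.ofReal (2 * η)) measurableSet_ball measurableSet_ball
    (hΩ.measurableSet.inter measurableSet_ball) inter_subset_left
    (subset_inter (hX.trans hu) hX) (subset_inter (hY.trans hu) hY) ?_ ?_
    (by rw [hv]; simpa using hβ) (by rw [hv]; simp) (by rw [hv]; simpa using hβ) (by rw [hv]; simp)
  · refine h.trans ?_
    rw [hv, hv, ← ENNReal.ofReal_inv_of_pos hβ]
    set J := ∫⁻ z in Ω ∩ ball u η, ‖fderiv ℝ f z‖ₑ ^ 2
    set β := Real.pi * (η/2) ^ 2 with hβd
    have h4 : (4 : ℝ≥0∞) = ENNReal.ofReal 4 := by simp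
    rw [h4, ← ENNReal.ofReal_add hβ.le hβ.le, ← ENNReal.ofReal_pow (by positivity),
      ← ENNReal.ofReal_mul (by norm_num), ← mul_assoc, ← mul_assoc, ← mul_assoc,
      ← ENNReal.ofReal_mul (by positivity), ← ENNReal.ofReal_mul (by positivity),
      ← ENNReal.ofReal_mul (by positivity)]
    gcongr
    have : β⁻¹ * β⁻¹ * (2 * η) ^ 2 * (4 * (β + β)) = 128 / Real.pi := by
      rw [hβd]; field_simp; norm_num
    rw [this, div_le_iff₀ Real.pi_pos]
    nlinarith [Real.pi_gt_three]
  · intro x hx y hy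
    have := (convex_ball u η).segment_subset (hX hx) (hY hy)
    exact subset_inter (this.trans hu) this
  · intro x hx y hy
    rw [← ofReal_norm, ← dist_eq_norm]
    apply ENNReal.ofReal_le_ofReal
    have h1 : dist x u < η := hX hx
    have h2 : dist y u < η := hY hy
    have := dist_triangle_right y x u
    linarith

/-- The cell around a net point. -/
def cell (Ω : Set E2) (η ε : ℝ) (c : E2) : Set E2 :=
  ⋃ k ∈ {k : E2 | ball k η ⊆ Ω ∧ dist k c < ε}, ball k η

lemma cell_open (Ω : Set E2) (η ε : ℝ) (c : E2) : IsOpen (cell Ω η ε c) :=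
  isOpen_biUnion fun _ _ => isOpen_ball

lemma mem_cell {Ω : Set E2} {η ε : ℝ} {c x : E2} :
    x ∈ cell Ω η ε c ↔ ∃ k, (ball k η ⊆ Ω ∧ dist k c < ε) ∧ x ∈ ball k η := by
  simp [cell]

lemma cell_vol {Ω : Set E2} {η ε : ℝ} (hη : 0 < η) (hε : ε ≤ η / 2) (c : E2) :
    volume (cell Ω η ε c) ≤ ENNReal.ofReal (16 * (Real.pi * (η/2)^2)) := by
  have : cell Ω η ε c ⊆ ball c (2 * η) := by
    intro x hx
    obtain ⟨k, ⟨h1, h2⟩, h3⟩ := mem_cell.1 hx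
    exact ball_subset_ball' (by linarith) h3
  refine (measure_mono this).trans (le_of_eq ?_)
  rw [vol_ball _ (by positivity)]
  congr 1; ring

lemma cell_bound {Ω : Set E2} (hΩ : IsOpen Ω) {f : E2 → ℝ} (hf : DifferentiableOn ℝ f Ω)
    (hfi : IntegrableOn f Ω volume) {η ε : ℝ} (hη : 0 < η) (hε0 : 0 < ε) (hε : ε ≤ η / 2) {c : E2}
    (hc : ball c η ⊆ Ω) :
    ∫⁻ x in cell Ω η ε c, ‖f x - locAvg f (η/2) c‖ₑ ^ 2 ≤
      ENNReal.ofReal (700 * η ^ 2) * ∫⁻ z in Ω ∩ ball c (2 * η), ‖fderiv ℝ f z‖ₑ ^ 2 := by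
  have hβ : 0 < Real.pi * (η/2) ^ 2 := by positivity
  have hY : ball c (η/2) ⊆ ball c (2 * η) := ball_subset_ball (by linarith)
  have hY' : ball c (η/2) ⊆ ball c η := ball_subset_ball (by linarith)
  have hv := fun w : E2 => vol_ball w (ρ := η/2) (by positivity)
  have key : ∀ x ∈ cell Ω η ε c, ∃ k, ball k η ⊆ Ω ∩ ball c (2 * η) ∧ x ∈ ball k η ∧
      ball c (η/2) ⊆ ball k η := by
    intro x hx
    obtain ⟨k, ⟨h1, h2⟩, h3⟩ := mem_cell.1 hx
    exact ⟨k, subset_inter h1 (ball_subset_ball' (by linarith)), h3,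
      ball_subset_ball' (by rw [dist_comm]; linarith)⟩
  have h := avg_X hΩ hf hfi (X := cell Ω η ε c) (Y := ball c (η/2)) (D := Ω ∩ ball c (2 * η))
    (d := ENNReal.ofReal (3 * η)) (cell_open _ _ _ _).measurableSet measurableSet_ball
    (hΩ.measurableSet.inter measurableSet_ball) inter_subset_left
    (subset_inter (hY'.trans hc) hY) ?_ ?_
    (by rw [hv]; simpa using hβ) (by rw [hv]; simp)
  · refine h.trans ?_
    set J := ∫⁻ z in Ω ∩ ball c (2 * η), ‖fderiv ℝ f z‖ₑ ^ 2
    refine le_trans (b := (volume (ball c (η/2)))⁻¹ * (ENNReal.ofReal (3 * η) ^ 2 *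
      (4 * (ENNReal.ofReal (16 * (Real.pi * (η/2)^2)) + volume (ball c (η/2))) * J))) ?_ ?_
    · gcongr; exact cell_vol hη hε c
    rw [hv, ← ENNReal.ofReal_inv_of_pos hβ]
    set β := Real.pi * (η/2) ^ 2 with hβd
    have h4 : (4 : ℝ≥0∞) = ENNReal.ofReal 4 := by simp
    rw [h4, ← ENNReal.ofReal_add (by positivity) hβ.le, ← ENNReal.ofReal_pow (by positivity),
      ← ENNReal.ofReal_mul (by norm_num), ← mul_assoc, ← mul_assoc,
      ← ENNReal.ofReal_mul (by positivity), ← ENNReal.ofReal_mul (by positivity)]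
    have : β⁻¹ * (3 * η) ^ 2 * (4 * (16 * β + β)) = 612 * η ^ 2 := by
      field_simp; norm_num
    rw [this]
    gcongr
    norm_num
  · intro x hx y hy
    obtain ⟨k, h1, h2, h3⟩ := key x hx
    exact ((convex_ball k η).segment_subset h2 (h3 hy)).trans h1
  · intro x hx y hy
    rw [← ofReal_norm, ← dist_eq_norm]
    apply ENNReal.ofReal_le_ofReal
    obtain ⟨k, h1, h2, h3⟩ := key x hx
    have h1 : dist x k < η := h2
    have h2 : dist y k < η := h3 hy
    have := dist_triangle_right y x k
    linarith

lemma net_mult {F : Finset E2} {ε R : ℝ} (h : Sep F ε) (hε : 0 < ε) (hR : R ≤ 40 * ε) (x : E2) :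
    (F.filter (fun u => dist u x < R)).card ≤ 6561 := by
  have h1 := (h.mono (Finset.filter_subset (fun u => dist u x < R) F)).card_ball hε (x := x)
    (R := 40 * ε) (by positivity) (fun u hu => ((Finset.mem_filter.1 hu).2).trans_le hR)
  have h2 : ((F.filter (fun u => dist u x < R)).card : ℝ) * ε ^ 2 ≤ 6561 * ε ^ 2 := by
    refine h1.trans (le_of_eq (by ring))
  exact_mod_cast le_of_mul_le_mul_right h2 (by positivity)

lemma pair_bound {Ω : Set E2} (hΩ : IsOpen Ω) (hc : IsPreconnected Ω) (hb : Bornology.IsBounded Ω)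
    (hne : Ω ≠ univ) {r : ℝ}
    {ν : E2 → E2} (hr : 0 < r) (h : NormalField Ω r ν) (hrP : r ≤ perim Ω)
    {f : E2 → ℝ} (hf : DifferentiableOn ℝ f Ω)
    (hfi : IntegrableOn f Ω volume) (hG : ∫⁻ z in Ω, ‖fderiv ℝ f z‖ₑ ^ 2 ≠ ∞)
    {Z : Finset E2} (hS : Sep Z (r/16)) (hZK : ∀ u ∈ Z, ball u (r/2) ⊆ Ω)
    (hZ : ∀ k, ball k (r/2) ⊆ Ω → ∃ u ∈ Z, dist k u < r/16) {c c0 : E2} (hcZ : c ∈ Z)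
    (hc0Z : c0 ∈ Z) :
    (locAvg f (r/2/2) c - locAvg f (r/2/2) c0) ^ 2 ≤
      768 * 6561 ^ 2 * (perim Ω / r) * (∫⁻ z in Ω, ‖fderiv ℝ f z‖ₑ ^ 2).toReal := by
  classical
  set a := locAvg f (r/2/2) with ha
  set I := ∫⁻ z in Ω, ‖fderiv ℝ f z‖ₑ ^ 2 with hI
  have hfin := h.perim_finite hΩ hb hr
  set F := Z.filter (fun u => u ∈ thickening (3 * (r/2)) (Ωᶜ ∪ segment ℝ c c0)) with hF
  set J : E2 → ℝ≥0∞ := fun u => ∫⁻ z in Ω ∩ ball u (r/2), ‖fderiv ℝ f z‖ₑ ^ 2 with hJ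
  have hJI : ∀ u, J u ≤ I := fun u => lintegral_mono_set inter_subset_left
  have hJf : ∀ u, J u ≠ ∞ := fun u => ne_top_of_le_ne_top hG (hJI u)
  have hFZ : F ⊆ Z := Finset.filter_subset _ _
  have hr16 : 0 < r/16 := by positivity
  have hreach := net_connected hΩ hc hne hr h hr16 (by linarith) hZK hZ hcZ hc0Z
    (F := F) (fun u hu hu' => Finset.mem_filter.2 ⟨hu, hu'⟩)
  have hcF : c ∈ F := Finset.mem_filter.2 ⟨hcZ, self_subset_thickening (by positivity) _
    (Or.inr (left_mem_segment ℝ c c0))⟩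
  have hgb := graph_bound (netGraph F (r/16)) F (fun u v huv => ⟨huv.2.1, huv.2.2.1⟩) a
    (fun u => 128 * (J u).toReal) (fun u => by positivity) (fun u v huv => by
      have := edge_bound hΩ hf hfi (η := r/2) (by positivity) (u := u) (v := v)
        (hZK u (hFZ huv.2.1)) (by have := huv.2.2.2; linarith)
      change _ ≤ _ * J u at this
      rw [enorm_sq_ofReal, ← ENNReal.ofReal_toReal (hJf u), ← ENNReal.ofReal_mul (by norm_num),
        ENNReal.ofReal_le_ofReal_iff (by positivity)] at this
      exact this) hcF hreach
  refine hgb.trans ?_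
  -- counting
  have hF1S : Sep (Z.filter (fun u => ∃ p ∈ frontier Ω, dist u p < 3 * (r/2))) (r/16) :=
    hS.mono (Finset.filter_subset _ _)
  have hF2S : Sep (Z.filter (fun u => ∃ p ∈ segment ℝ c c0, dist u p < 3 * (r/2))) (r/16) :=
    hS.mono (Finset.filter_subset _ _)
  have c1 := count_frontier hr h hfin (fun x => net_mult hF1S hr16 (by linarith) x)
    (fun u hu => (Finset.mem_filter.1 hu).2)
  have c2 := count_segment (η := r/2) (by positivity)
    (fun x => net_mult hF2S hr16 (by linarith) x)
    (fun u hu => (Finset.mem_filter.1 hu).2)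
  have hsub : F ⊆ (Z.filter (fun u => ∃ p ∈ frontier Ω, dist u p < 3 * (r/2))) ∪
      (Z.filter (fun u => ∃ p ∈ segment ℝ c c0, dist u p < 3 * (r/2))) := by
    intro u hu
    obtain ⟨huZ, hu2⟩ := Finset.mem_filter.1 hu
    obtain ⟨s, hs, hsd⟩ := mem_thickening_iff.1 hu2
    rw [Finset.mem_union, Finset.mem_filter, Finset.mem_filter]
    rcases hs with hs | hs
    · left
      refine ⟨huZ, ?_⟩
      obtain ⟨t, ht, hp⟩ := segment_frontier (hZK u huZ (mem_ball_self (by positivity))) hs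
      refine ⟨_, hp, lt_of_le_of_lt ?_ hsd⟩
      rw [dist_eq_norm, dist_eq_norm', sub_add_cancel_left, norm_neg, norm_smul,
        Real.norm_of_nonneg ht.1]
      exact mul_le_of_le_one_left (norm_nonneg _) ht.2
    · exact Or.inr ⟨huZ, s, hs, hsd⟩
  have hdist : dist c c0 ≤ perim Ω := by
    have := dist_le_perim hc hb (hZK c hcZ (mem_ball_self (by positivity)))
      (hZK c0 hc0Z (mem_ball_self (by positivity)))
    have := ENNReal.toReal_mono hfin.ne this
    rwa [ENNReal.toReal_ofReal dist_nonneg] at this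
  have hPr : 1 ≤ perim Ω / r := by rwa [one_le_div hr]
  have hcard : (F.card : ℝ) ≤ 6 * 6561 * (perim Ω / r) := by
    have c3 : (F.card : ℝ) ≤ _ := Nat.cast_le.2
      ((Finset.card_le_card hsub).trans (Finset.card_union_le _ _))
    rw [Nat.cast_add] at c3
    rw [← le_div_iff₀ hr, mul_div_assoc] at c1
    have c4 : dist c c0 / (r/2) ≤ 2 * (perim Ω / r) := by
      rw [div_le_iff₀ (by positivity)]
      have : 2 * (perim Ω / r) * (r / 2) = perim Ω := by field_simp
      linarith
    push_cast at c1 c2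
    linarith
  have hsum : ∑ u ∈ F, 128 * (J u).toReal ≤ 128 * (6561 * I.toReal) := by
    rw [← Finset.mul_sum, ← ENNReal.toReal_sum (fun u _ => hJf u)]
    have := overlap_sum volume (G := fun z => ‖fderiv ℝ f z‖ₑ ^ 2)
      ((measurable_fderiv ℝ f).enorm.pow_const 2) Ω F (r/2) 6561
      (fun x => net_mult (hS.mono hFZ) hr16 (by linarith) x)
    have := ENNReal.toReal_mono (ENNReal.mul_ne_top (by simp) hG) this
    rw [ENNReal.toReal_mul, ENNReal.toReal_natCast] at this
    push_cast at this
    gcongr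
  calc (F.card : ℝ) * ∑ u ∈ F, 128 * (J u).toReal
      ≤ (6 * 6561 * (perim Ω / r)) * (128 * (6561 * I.toReal)) := by
        gcongr
    _ = _ := by ring

lemma lintegral_biUnion_finset_le' (F : Finset E2) (X : E2 → Set E2) (g : E2 → ℝ≥0∞) :
    ∫⁻ x in ⋃ u ∈ F, X u, g x ≤ ∑ u ∈ F, ∫⁻ x in X u, g x := by
  classical
  induction F using Finset.induction_on with
  | empty => simp
  | insert u F hu ih =>
    rw [Finset.set_biUnion_insert, Finset.sum_insert hu]
    exact (lintegral_union_le _ _ _).trans (by gcongr)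

lemma main_r {Ω : Set E2} (hΩ : IsOpen Ω) (hc : IsConnected Ω) (hb : Bornology.IsBounded Ω)
    {r : ℝ} (hU : IsUBCWith Ω r) {f : E2 → ℝ} (hf : DifferentiableOn ℝ f Ω)
    (hfi : IntegrableOn f Ω volume) (hG : ∫⁻ z in Ω, ‖fderiv ℝ f z‖ₑ ^ 2 ≠ ∞) :
    ∃ a0 : ℝ, ∫⁻ x in Ω, ‖f x - a0‖ₑ ^ 2 ≤ ENNReal.ofReal ((1400 * 6561 + 2048 * 768 * 6561 ^ 2) *
      (area Ω * perim Ω / r) * (∫⁻ z in Ω, ‖fderiv ℝ f z‖ₑ ^ 2).toReal) := by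
  classical
  have hr := hU.1
  obtain ⟨ν, h⟩ := exists_normalField hU
  have hne : Ω ≠ univ := by
    rintro rfl
    exact NormedSpace.unbounded_univ ℝ E2 hb
  have hfin := h.perim_finite hΩ hb hr
  obtain ⟨p0, hp0⟩ : (frontier Ω).Nonempty := nonempty_frontier_iff.2 ⟨hc.nonempty, hne⟩
  have hrP : r ≤ perim Ω := by
    have := (h.perim_lower hr hp0).trans (measure_mono inter_subset_left)
    have := ENNReal.toReal_mono hfin.ne this
    rwa [ENNReal.toReal_ofReal hr.le] at this
  have hvol : volume Ω ≠ ∞ := hb.measure_lt_top.ne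
  have hA : r ^ 2 ≤ area Ω := by
    have := measure_mono (μ := volume) (h p0 hp0).2.1
    rw [vol_ball _ hr.le] at this
    have := ENNReal.toReal_mono hvol this
    rw [ENNReal.toReal_ofReal (by positivity)] at this
    unfold area
    nlinarith [Real.pi_gt_three, sq_nonneg r]
  have hr16 : 0 < r/16 := by positivity
  obtain ⟨Z, hZK, hS, hZ⟩ := exists_net (K := {k | ball k (r/2) ⊆ Ω}) (A := Ω) hr16 hvol
    (fun u hu => (ball_subset_ball (by linarith)).trans hu)
  replace hZK : ∀ u ∈ Z, ball u (r/2) ⊆ Ω := fun u hu => hZK hu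
  obtain ⟨k, hk1, -, -⟩ := exists_centre_map hΩ hne hr h
  have hcover : Ω ⊆ ⋃ u ∈ Z, cell Ω (r/2) (r/16) u := by
    intro x hx
    obtain ⟨u, hu, hd⟩ := hZ (k x) (hk1 x hx).1
    exact mem_iUnion₂.2 ⟨u, hu, mem_cell.2 ⟨k x, ⟨(hk1 x hx).1, hd⟩, (hk1 x hx).2⟩⟩
  obtain ⟨x0, hx0⟩ := hc.nonempty
  obtain ⟨c0, hc0Z, -⟩ := hZ (k x0) (hk1 x0 hx0).1
  set a := locAvg f (r/2/2) with ha
  set I := ∫⁻ z in Ω, ‖fderiv ℝ f z‖ₑ ^ 2 with hI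
  set Q := 768 * 6561 ^ 2 * (perim Ω / r) * I.toReal with hQ
  have hPr : 0 ≤ perim Ω / r := div_nonneg (hr.le.trans hrP) hr.le
  have hQ0 : 0 ≤ Q := by positivity
  set β := Real.pi * (r/2/2) ^ 2 with hβ
  have hβ0 : 0 ≤ β := by positivity
  refine ⟨a c0, ?_⟩
  have hcell : ∀ c ∈ Z, ∫⁻ x in cell Ω (r/2) (r/16) c, ‖f x - a c0‖ₑ ^ 2 ≤
      ENNReal.ofReal (1400 * (r/2)^2) * (∫⁻ z in Ω ∩ ball c (2 * (r/2)), ‖fderiv ℝ f z‖ₑ ^ 2) +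
        ENNReal.ofReal (2 * Q * (16 * β)) := by
    intro c hcZ
    have hpair := pair_bound hΩ hc.isPreconnected hb hne hr h hrP hf hfi hG hS hZK hZ hcZ hc0Z
    have hcb := cell_bound hΩ hf hfi (η := r/2) (ε := r/16) (by positivity) hr16 (by linarith)
      (hZK c hcZ)
    have hcv := cell_vol (Ω := Ω) (η := r/2) (ε := r/16) (by positivity) (by linarith) c
    calc ∫⁻ x in cell Ω (r/2) (r/16) c, ‖f x - a c0‖ₑ ^ 2
        ≤ ∫⁻ x in cell Ω (r/2) (r/16) c, (ENNReal.ofReal 2 * ‖f x - a c‖ₑ ^ 2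
            + ENNReal.ofReal (2 * Q)) := by
          gcongr with x
          rw [enorm_sq_ofReal, enorm_sq_ofReal, ← ENNReal.ofReal_mul (by norm_num),
            ← ENNReal.ofReal_add (by positivity) (by positivity)]
          apply ENNReal.ofReal_le_ofReal
          nlinarith [sq_nonneg ((f x - a c) - (a c - a c0))]
      _ = ENNReal.ofReal 2 * (∫⁻ x in cell Ω (r/2) (r/16) c, ‖f x - a c‖ₑ ^ 2)
            + ENNReal.ofReal (2 * Q) * volume (cell Ω (r/2) (r/16) c) := by
          rw [lintegral_add_right _ measurable_const, lintegral_const_mul' _ _ (by simp),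
            lintegral_const, Measure.restrict_apply_univ]
      _ ≤ ENNReal.ofReal 2 * (ENNReal.ofReal (700 * (r/2) ^ 2) *
            ∫⁻ z in Ω ∩ ball c (2 * (r/2)), ‖fderiv ℝ f z‖ₑ ^ 2)
            + ENNReal.ofReal (2 * Q) * ENNReal.ofReal (16 * β) := by gcongr
      _ = _ := by
          rw [← mul_assoc, ← ENNReal.ofReal_mul (by norm_num), ← ENNReal.ofReal_mul (by positivity)]
          congr 3; ring
  have hover := overlap_sum volume (G := fun z => ‖fderiv ℝ f z‖ₑ ^ 2)
      ((measurable_fderiv ℝ f).enorm.pow_const 2) Ω Z (2 * (r/2)) 6561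
      (fun x => net_mult hS hr16 (by linarith) x)
  have hcount : (Z.card : ℝ) * β ≤ 64 * area Ω := by
    have := hS.card_volume hr16 (A := Ω)
      (fun u hu => (ball_subset_ball (by linarith)).trans (hZK u hu))
    have := ENNReal.toReal_mono hvol this
    rw [ENNReal.toReal_mul, ENNReal.toReal_natCast, ENNReal.toReal_ofReal (by positivity)] at this
    unfold area
    rw [hβ]
    nlinarith
  calc ∫⁻ x in Ω, ‖f x - a c0‖ₑ ^ 2
      ≤ ∫⁻ x in ⋃ u ∈ Z, cell Ω (r/2) (r/16) u, ‖f x - a c0‖ₑ ^ 2 := lintegral_mono_set hcover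
    _ ≤ ∑ c ∈ Z, ∫⁻ x in cell Ω (r/2) (r/16) c, ‖f x - a c0‖ₑ ^ 2 :=
        lintegral_biUnion_finset_le' _ _ _
    _ ≤ ∑ c ∈ Z, (ENNReal.ofReal (1400 * (r/2)^2) *
          (∫⁻ z in Ω ∩ ball c (2 * (r/2)), ‖fderiv ℝ f z‖ₑ ^ 2) +
        ENNReal.ofReal (2 * Q * (16 * β))) := Finset.sum_le_sum hcell
    _ = ENNReal.ofReal (1400 * (r/2)^2) *
          (∑ c ∈ Z, ∫⁻ z in Ω ∩ ball c (2 * (r/2)), ‖fderiv ℝ f z‖ₑ ^ 2) +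
        Z.card * ENNReal.ofReal (2 * Q * (16 * β)) := by
        rw [Finset.sum_add_distrib, Finset.mul_sum, Finset.sum_const, nsmul_eq_mul]
    _ ≤ ENNReal.ofReal (1400 * (r/2)^2) * ((6561 : ℕ) * I) +
        Z.card * ENNReal.ofReal (2 * Q * (16 * β)) := by gcongr
    _ = ENNReal.ofReal (1400 * (r/2)^2 * (6561 * I.toReal) + Z.card * (2 * Q * (16 * β))) := by
        rw [ENNReal.ofReal_add (by positivity) (by positivity),
          ENNReal.ofReal_mul (p := 1400 * (r/2)^2) (by positivity),
          ENNReal.ofReal_mul (p := 6561) (by positivity),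
          ENNReal.ofReal_mul (p := (Z.card : ℝ)) (by positivity),
          ENNReal.ofReal_toReal hG, ENNReal.ofReal_natCast]
        norm_num
    _ ≤ _ := by
        apply ENNReal.ofReal_le_ofReal
        have hI0 : 0 ≤ I.toReal := ENNReal.toReal_nonneg
        have e1 : (r/2)^2 ≤ area Ω * perim Ω / r := by
          rw [mul_div_assoc]
          have : 1 ≤ perim Ω / r := by rwa [one_le_div hr]
          nlinarith [sq_nonneg r]
        have e2 : Z.card * (2 * Q * (16 * β)) ≤ 2048 * Q * area Ω := by
          nlinarith [mul_le_mul_of_nonneg_left hcount hQ0]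
        have e3 : 2048 * Q * area Ω =
            2048 * 768 * 6561 ^ 2 * (area Ω * perim Ω / r) * I.toReal := by rw [hQ]; ring
        have e4 : 1400 * (r/2)^2 * (6561 * I.toReal) ≤
            1400 * 6561 * (area Ω * perim Ω / r) * I.toReal := by
          nlinarith [mul_le_mul_of_nonneg_right e1 hI0]
        linarith

lemma var_min {Ω : Set E2} (hvol : volume Ω ≠ ∞) (hA : 0 < area Ω) {f : E2 → ℝ}
    (hfi : IntegrableOn f Ω volume) (hf2 : IntegrableOn (fun x => (f x)^2) Ω volume) (a : ℝ) :
    (∫ x in Ω, (f x - (area Ω)⁻¹ * ∫ y in Ω, f y)^2) ≤ ∫ x in Ω, (f x - a)^2 := by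
  have hfinite : IsFiniteMeasure (volume.restrict Ω) := ⟨by simpa using lt_top_iff_ne_top.2 hvol⟩
  have expand : ∀ s : ℝ, ∫ x in Ω, (f x - s)^2 =
      (∫ x in Ω, (f x)^2) - 2 * s * (∫ x in Ω, f x) + s ^ 2 * area Ω := by
    intro s
    have : ∀ x, (f x - s)^2 = (f x)^2 - 2 * s * f x + s ^ 2 := fun x => by ring
    simp_rw [this]
    have hsub : Integrable (fun x => (f x)^2 - 2 * s * f x) (volume.restrict Ω) :=
      hf2.sub (hfi.const_mul _)
    rw [integral_add hsub (integrable_const _),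
      integral_sub hf2 (hfi.const_mul _), integral_const_mul, integral_const]
    simp [area, Measure.real, mul_comm]
  rw [expand, expand]
  set S := ∫ x in Ω, f x
  set A := area Ω
  have h1 : A⁻¹ * S * A = S := by field_simp
  set m := A⁻¹ * S
  rw [← h1]
  nlinarith [mul_nonneg hA.le (sq_nonneg (m - a))]

/-- Lemma 2.6, quantified Poincaré inequality: for UBC domains,
`∫_Ω |f - f_Ω|² ≤ C (|Ω| P(Ω) / r_Ω) ∫_Ω |∇f|²` with an independent constant `C`. -/
theorem quantified_poincare :
    ∃ C : ℝ, ∀ Ω : Set E2, IsUBCDomain Ω → ∀ f : E2 → ℝ,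
      DifferentiableOn ℝ f Ω →
      IntegrableOn f Ω volume →
      IntegrableOn (fun x => (f x)^2) Ω volume →
      IntegrableOn (fun x => ‖fderiv ℝ f x‖^2) Ω volume →
      (∫ x in Ω, (f x - (area Ω)⁻¹ * ∫ y in Ω, f y)^2) ≤
        C * (area Ω * perim Ω / ubcRadius Ω) * ∫ x in Ω, ‖fderiv ℝ f x‖^2 := by
  refine ⟨1400 * 6561 + 2048 * 768 * 6561 ^ 2, ?_⟩
  rintro Ω ⟨hΩ, hc, hb, hex⟩ f hf hfi hf2 hg2
  set C : ℝ := 1400 * 6561 + 2048 * 768 * 6561 ^ 2 with hC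
  have hC0 : 0 < C := by rw [hC]; norm_num
  have hvol : volume Ω ≠ ∞ := hb.measure_lt_top.ne
  have hA : 0 < area Ω := ENNReal.toReal_pos (hΩ.measure_pos volume hc.nonempty).ne' hvol
  have hfinite : IsFiniteMeasure (volume.restrict Ω) := ⟨by simpa using lt_top_iff_ne_top.2 hvol⟩
  have hIeq : ENNReal.ofReal (∫ x in Ω, ‖fderiv ℝ f x‖^2) = ∫⁻ z in Ω, ‖fderiv ℝ f z‖ₑ ^ 2 := by
    rw [ofReal_integral_eq_lintegral_ofReal hg2 (Eventually.of_forall fun x => by positivity)]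
    congr 1; ext x
    rw [← ofReal_norm, ENNReal.ofReal_pow (norm_nonneg _)]
  have hI0 : 0 ≤ ∫ x in Ω, ‖fderiv ℝ f x‖^2 := integral_nonneg fun x => by positivity
  set I := ∫ x in Ω, ‖fderiv ℝ f x‖^2 with hI
  set L := ∫ x in Ω, (f x - (area Ω)⁻¹ * ∫ y in Ω, f y)^2 with hL
  have hP0 : 0 ≤ perim Ω := ENNReal.toReal_nonneg
  have key : ∀ r, IsUBCWith Ω r → L ≤ C * (area Ω * perim Ω / r) * I := by
    intro r hU
    have hr := hU.1
    obtain ⟨a0, ha0⟩ := main_r hΩ hc hb hU hf hfi (by rw [← hIeq]; simp)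
    rw [← hIeq, ENNReal.toReal_ofReal hI0] at ha0
    refine (var_min hvol hA hfi hf2 a0).trans ?_
    have hIntg : IntegrableOn (fun x => (f x - a0)^2) Ω volume := by
      have : (fun x => (f x - a0)^2) = fun x => (f x)^2 - 2 * a0 * f x + a0 ^ 2 := by
        ext x; ring
      rw [this]
      exact (hf2.sub (hfi.const_mul _)).add (integrable_const _)
    rw [← ENNReal.ofReal_le_ofReal_iff (by positivity),
      ofReal_integral_eq_lintegral_ofReal hIntg (Eventually.of_forall fun x => by positivity)]
    simp_rw [enorm_sq_ofReal] at ha0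
    exact ha0
  obtain ⟨r0, hr0⟩ := hex
  rcases le_or_gt L 0 with hL0 | hL0
  · refine hL0.trans ?_
    have : 0 ≤ ubcRadius Ω := Real.sSup_nonneg fun r hr => hr.1.le
    positivity
  · have hbound : ∀ r ∈ {r : ℝ | IsUBCWith Ω r}, r ≤ C * (area Ω * perim Ω) * I / L := by
      intro r hU
      have h1 := key r hU
      have hr := hU.1
      rw [le_div_iff₀ hL0]
      have : C * (area Ω * perim Ω / r) * I * r = C * (area Ω * perim Ω) * I := by field_simp
      nlinarith [mul_le_mul_of_nonneg_right h1 hr.le]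
    have h1 : ubcRadius Ω ≤ C * (area Ω * perim Ω) * I / L := csSup_le ⟨r0, hr0⟩ hbound
    have h2 : 0 < ubcRadius Ω := hr0.1.trans_le (le_csSup ⟨_, hbound⟩ hr0)
    rw [le_div_iff₀ hL0] at h1
    have : C * (area Ω * perim Ω / ubcRadius Ω) * I = C * (area Ω * perim Ω) * I / ubcRadius Ω := by
      ring
    rw [this, le_div_iff₀ h2]
    linarith

end StokesPaper

end
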